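/- arXiv:1905.11504 — 2 statements merged into one kernel-verified Lean document; each statement's English description precedes it below -/
import Mathlib

section
/- For every w > 0 there exist a constant c > 0 and α₀ such that for all α ≥ α₀ and all λ with 0 < λ ≤ (2Kα/log α)(1 − ε_w/K − c (f'(w) + 1)/log α), problem (P_{α,λ}) admits a solution u; moreover u may be chosen so that ∫_{u(0)}^∞ ds/f(s) ≥ ε_w (equivalently u(0) ≤ w). Here ε_w := ∫_w^∞ ds/f(s). -/
open Set MeasureTheory Filter

/-- The standing data and assumptions of the Gelfand-type problem for
auto-ignition of a free round turbulent jet: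
`f : [0,∞) → (0,∞)` is `C¹`, convex, non-decreasing with `K = ∫₀^∞ ds / f s < ∞`;
`φ, ψ : [0,1] → [0,∞)` are non-increasing Lipschitz with `φ 0 = ψ 0 = 1`,
`φ > 0` on `[0,1)`, and `M s = max_{r ∈ [0,s]} ψ r / φ r` is integrable on `(0,1)`. -/
structure GelfandData where
  f : ℝ → ℝ
  phi : ℝ → ℝ
  psi : ℝ → ℝ
  M : ℝ → ℝ
  K : ℝ
  f_pos : ∀ s, 0 ≤ s → 0 < f s
  f_smooth : ContDiffOn ℝ 1 f (Ici 0)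
  f_convex : ConvexOn ℝ (Ici 0) f
  f_mono : MonotoneOn f (Ici 0)
  f_int : IntegrableOn (fun s => 1 / f s) (Ioi 0)
  K_def : K = ∫ s in Ioi (0:ℝ), 1 / f s
  phi_nonneg : ∀ r ∈ Icc (0:ℝ) 1, 0 ≤ phi r
  psi_nonneg : ∀ r ∈ Icc (0:ℝ) 1, 0 ≤ psi r
  phi_anti : AntitoneOn phi (Icc 0 1)
  psi_anti : AntitoneOn psi (Icc 0 1)
  phi_lip : ∃ L, LipschitzOnWith L phi (Icc 0 1)
  psi_lip : ∃ L, LipschitzOnWith L psi (Icc 0 1)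
  phi_zero : phi 0 = 1
  psi_zero : psi 0 = 1
  phi_pos : ∀ r ∈ Ico (0:ℝ) 1, 0 < phi r
  M_def : ∀ s ∈ Ico (0:ℝ) 1, IsGreatest ((fun r => psi r / phi r) '' Icc 0 s) (M s)
  M_int : IntegrableOn M (Ioo 0 1)

/-- `u` is a (classical, radial) solution of problem `(P_{α,λ})`:
`u ∈ C²((0,1)) ∩ C¹([0,1])`, `u > 0` on `[0,1)`, `u'(0) = 0`, `u 1 = 0`, and
`-u'' - (1/r + α r φ(r)) u' = λ ψ(r) f(u(r))` on `(0,1)`. -/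
def IsSolution (D : GelfandData) (α lam : ℝ) (u : ℝ → ℝ) : Prop :=
  ContDiffOn ℝ 1 u (Icc 0 1) ∧ ContDiffOn ℝ 2 u (Ioo 0 1) ∧
  (∀ r ∈ Ico (0:ℝ) 1, 0 < u r) ∧
  derivWithin u (Icc 0 1) 0 = 0 ∧ u 1 = 0 ∧
  ∀ r ∈ Ioo (0:ℝ) 1,
    -(derivWithin (derivWithin u (Icc 0 1)) (Ioo 0 1) r)
      - (1 / r + α * r * D.phi r) * derivWithin u (Icc 0 1) r
      = lam * D.psi r * D.f (u r)

/-- The set of `λ > 0` for which problem `(P_{α,λ})` admits a solution. -/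
def solvableSet (D : GelfandData) (α : ℝ) : Set ℝ :=
  {lam | 0 < lam ∧ ∃ u, IsSolution D α lam u}

/-- The extremal Frank-Kamenetskii parameter `λ*(α)`. -/
noncomputable def lamStar (D : GelfandData) (α : ℝ) : ℝ := sSup (solvableSet D α)

/-- The weight `μ(r) = exp(α ∫₀^r s φ(s) ds)`. -/
noncomputable def muW (D : GelfandData) (α r : ℝ) : ℝ :=
  Real.exp (α * ∫ s in (0:ℝ)..r, s * D.phi s)

/-- `u` is a semistable solution: for every `C¹` test function `η` with `η 1 = 0`,
`∫₀¹ η'^2 μ r dr ≥ λ ∫₀¹ ψ f'(u) η² μ r dr`. -/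
def IsSemistable (D : GelfandData) (α lam : ℝ) (u : ℝ → ℝ) : Prop :=
  ∀ η : ℝ → ℝ, ContDiff ℝ 1 η → η 1 = 0 →
    lam * ∫ r in Ioo (0:ℝ) 1,
        D.psi r * derivWithin D.f (Ici 0) (u r) * (η r) ^ 2 * muW D α r * r
      ≤ ∫ r in Ioo (0:ℝ) 1, (deriv η r) ^ 2 * muW D α r * r


noncomputable def clampU (x : ℝ) : ℝ := max 0 (min x 1)

lemma clampU_cont : Continuous clampU := by unfold clampU; fun_prop
lemma clampU_mem (x : ℝ) : clampU x ∈ Icc (0:ℝ) 1 := by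
  unfold clampU; exact ⟨le_max_left _ _, max_le (by norm_num) (min_le_right _ _)⟩
lemma clampU_eq {x : ℝ} (h : x ∈ Icc (0:ℝ) 1) : clampU x = x := by
  unfold clampU; rw [min_eq_left h.2, max_eq_right h.1]
lemma clampU_lip (x y : ℝ) : |clampU x - clampU y| ≤ |x - y| := by
  unfold clampU
  rw [max_comm, max_comm 0]
  exact (abs_max_sub_max_le_abs _ _ _).trans (abs_inf_sub_inf_le_abs _ _ _)

noncomputable def pOp (μ h : ℝ → ℝ) (t : ℝ) : ℝ :=
  t / μ t * ∫ x in (0:ℝ)..1, x * h (t * x) * μ (t * x)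

lemma pOp_cont {μ h : ℝ → ℝ} (hμ : Continuous μ) (hμ0 : ∀ x, 0 < μ x) (hh : Continuous h) :
    Continuous (pOp μ h) := by
  unfold pOp
  refine (continuous_id.div hμ (fun x => (hμ0 x).ne')).mul ?_
  apply intervalIntegral.continuous_parametric_intervalIntegral_of_continuous'
  fun_prop

lemma pOp_eq {μ h : ℝ → ℝ} {t : ℝ} (ht : t ≠ 0) :
    pOp μ h t = (∫ s in (0:ℝ)..t, s * h s * μ s) / (t * μ t) := by
  unfold pOp
  have := intervalIntegral.integral_comp_mul_left (a := 0) (b := 1)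
    (fun s => s * h s * μ s) ht
  simp only [mul_zero, mul_one, smul_eq_mul] at this
  have h2 : (∫ x in (0:ℝ)..1, t * x * h (t * x) * μ (t * x))
      = t * ∫ x in (0:ℝ)..1, x * h (t * x) * μ (t * x) := by
    rw [← intervalIntegral.integral_const_mul]
    congr 1; ext x; ring
  rw [h2] at this
  have h3 : (∫ s in (0:ℝ)..t, s * h s * μ s)
    = t * (t * ∫ x in (0:ℝ)..1, x * h (t * x) * μ (t * x)) := by
    rw [this]; field_simp
  rw [h3]; field_simp

lemma pOp_nonneg {μ h : ℝ → ℝ} (hμ0 : ∀ x, 0 < μ x) (hh : ∀ x, 0 ≤ h x) {t : ℝ} (ht : 0 ≤ t) :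
    0 ≤ pOp μ h t := by
  unfold pOp
  refine mul_nonneg (div_nonneg ht (hμ0 t).le) ?_
  apply intervalIntegral.integral_nonneg (by norm_num)
  intro x hx
  exact mul_nonneg (mul_nonneg hx.1 (hh _)) (hμ0 _).le

lemma pOp_mono {μ h k : ℝ → ℝ} (hμ : Continuous μ) (hμ0 : ∀ x, 0 < μ x) (hh : Continuous h)
    (hk : Continuous k) (hhk : ∀ x, h x ≤ k x) {t : ℝ} (ht : 0 ≤ t) :
    pOp μ h t ≤ pOp μ k t := by
  unfold pOp
  refine mul_le_mul_of_nonneg_left ?_ (div_nonneg ht (hμ0 t).le)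
  apply intervalIntegral.integral_mono_on (by norm_num)
  · apply Continuous.intervalIntegrable; fun_prop
  · apply Continuous.intervalIntegrable; fun_prop
  intro x hx
  exact mul_le_mul_of_nonneg_right (mul_le_mul_of_nonneg_left (hhk _) hx.1) (hμ0 _).le

lemma pOp_le {μ h : ℝ → ℝ} (hμ : Continuous μ) (hμ0 : ∀ x, 0 < μ x)
    (hmono : MonotoneOn μ (Icc 0 1)) (hh : Continuous h) {A : ℝ} (hA : 0 ≤ A)
    (hhA : ∀ x, h x ≤ A) {t : ℝ} (ht : t ∈ Icc (0:ℝ) 1) :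
    pOp μ h t ≤ A := by
  have h1 : ∫ x in (0:ℝ)..1, x * h (t * x) * μ (t * x) ≤ ∫ x in (0:ℝ)..1, A * μ t := by
    apply intervalIntegral.integral_mono_on (by norm_num)
    · apply Continuous.intervalIntegrable; fun_prop
    · apply Continuous.intervalIntegrable; fun_prop
    intro x hx
    have htx : t * x ≤ t := by nlinarith [ht.1, hx.2]
    have h2 : μ (t * x) ≤ μ t :=
      hmono ⟨mul_nonneg ht.1 hx.1, htx.trans ht.2⟩ ht htx
    have h3 : x * h (t * x) ≤ A := by
      have := mul_le_mul_of_nonneg_left (hhA (t * x)) hx.1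
      nlinarith [hx.2]
    calc _ ≤ A * μ (t * x) := mul_le_mul_of_nonneg_right h3 (hμ0 _).le
      _ ≤ _ := mul_le_mul_of_nonneg_left h2 hA
  rw [intervalIntegral.integral_const] at h1
  simp at h1
  unfold pOp
  calc _ ≤ t / μ t * (A * μ t) := mul_le_mul_of_nonneg_left h1 (div_nonneg ht.1 (hμ0 t).le)
    _ = t * A := by have := (hμ0 t).ne'; field_simp
    _ ≤ A := by nlinarith [ht.2]

noncomputable def TOp (μ : ℝ → ℝ) (h : ℝ → ℝ) (r : ℝ) : ℝ := ∫ t in (clampU r)..1, pOp μ h t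

lemma TOp_lip {μ h : ℝ → ℝ} (hμ : Continuous μ) (hμ0 : ∀ x, 0 < μ x)
    (hmono : MonotoneOn μ (Icc 0 1)) (hh : Continuous h) {A : ℝ} (hA : 0 ≤ A)
    (hh0 : ∀ x, 0 ≤ h x) (hhA : ∀ x, h x ≤ A) (r s : ℝ) :
    |TOp μ h r - TOp μ h s| ≤ A * |r - s| := by
  have hc := pOp_cont hμ hμ0 hh
  unfold TOp
  have : (∫ t in (clampU r)..1, pOp μ h t) - (∫ t in (clampU s)..1, pOp μ h t)
      = ∫ t in (clampU r)..(clampU s), pOp μ h t := by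
    rw [← intervalIntegral.integral_add_adjacent_intervals (hc.intervalIntegrable (clampU r) (clampU s))
    (hc.intervalIntegrable (clampU s) 1)]; ring
  rw [this]
  have h2 := intervalIntegral.norm_integral_le_of_norm_le_const (a := clampU r) (b := clampU s)
    (f := pOp μ h) (C := A) (by
      intro x hx
      have hx' : x ∈ Icc (0:ℝ) 1 := by
        have h1 := uIoc_subset_uIcc hx
        exact (uIcc_subset_Icc (clampU_mem r) (clampU_mem s)) h1
      rw [Real.norm_eq_abs, abs_of_nonneg (pOp_nonneg hμ0 hh0 hx'.1)]
      exact pOp_le hμ hμ0 hmono hh hA hhA hx')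
  rw [Real.norm_eq_abs, abs_sub_comm] at h2
  exact h2.trans (mul_le_mul_of_nonneg_left (clampU_lip r s) hA)

lemma TOp_nonneg {μ h : ℝ → ℝ} (hμ0 : ∀ x, 0 < μ x) (hh : ∀ x, 0 ≤ h x) (r : ℝ) :
    0 ≤ TOp μ h r := by
  unfold TOp
  apply intervalIntegral.integral_nonneg (clampU_mem r).2
  intro x hx
  exact pOp_nonneg hμ0 hh ((clampU_mem r).1.trans hx.1)

lemma TOp_mono {μ h k : ℝ → ℝ} (hμ : Continuous μ) (hμ0 : ∀ x, 0 < μ x) (hh : Continuous h)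
    (hk : Continuous k) (hhk : ∀ x, h x ≤ k x) (r : ℝ) :
    TOp μ h r ≤ TOp μ k r := by
  unfold TOp
  apply intervalIntegral.integral_mono_on (clampU_mem r).2
  · exact (pOp_cont hμ hμ0 hh).intervalIntegrable _ _
  · exact (pOp_cont hμ hμ0 hk).intervalIntegrable _ _
  intro x hx
  exact pOp_mono hμ hμ0 hh hk hhk ((clampU_mem r).1.trans hx.1)

lemma TOp_tendsto {μ : ℝ → ℝ} (hμ : Continuous μ) (hμ0 : ∀ x, 0 < μ x)
    (hmono : MonotoneOn μ (Icc 0 1)) {h : ℕ → ℝ → ℝ} {k : ℝ → ℝ}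
    (hh : ∀ n, Continuous (h n)) {A : ℝ} (hA : 0 ≤ A)
    (hh0 : ∀ n x, 0 ≤ h n x) (hhA : ∀ n x, h n x ≤ A)
    (hlim : ∀ x, Tendsto (fun n => h n x) atTop (nhds (k x))) (r : ℝ) :
    Tendsto (fun n => TOp μ (h n) r) atTop (nhds (TOp μ k r)) := by
  unfold TOp
  apply intervalIntegral.tendsto_integral_filter_of_dominated_convergence (fun _ => A)
  · exact Eventually.of_forall fun n => (pOp_cont hμ hμ0 (hh n)).aestronglyMeasurable
  · refine Eventually.of_forall fun n => Eventually.of_forall fun x hx => ?_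
    rw [uIoc_of_le (clampU_mem r).2] at hx
    have hx' : x ∈ Icc (0:ℝ) 1 := ⟨(clampU_mem r).1.trans hx.1.le, hx.2⟩
    rw [Real.norm_eq_abs, abs_of_nonneg (pOp_nonneg hμ0 (hh0 n) hx'.1)]
    exact pOp_le hμ hμ0 hmono (hh n) hA (hhA n) hx'
  · simp
  · refine Eventually.of_forall fun t _ => ?_
    unfold pOp
    apply Tendsto.const_mul
    apply intervalIntegral.tendsto_integral_filter_of_dominated_convergence
      (fun x => |x| * A * μ (t * x))
    · refine Eventually.of_forall fun n => Continuous.aestronglyMeasurable ?_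
      have := hh n
      fun_prop
    · refine Eventually.of_forall fun n => Eventually.of_forall fun x hx => ?_
      rw [Real.norm_eq_abs, abs_mul, abs_mul, abs_of_pos (hμ0 _), abs_of_nonneg (hh0 n _)]
      exact mul_le_mul_of_nonneg_right (mul_le_mul_of_nonneg_left (hhA n _) (abs_nonneg _)) (hμ0 _).le
    · apply Continuous.intervalIntegrable; fun_prop
    · exact Eventually.of_forall fun x _ => ((hlim (t * x)).const_mul x).mul_const _

/-- Monotone iteration. -/
lemma exists_fixed {μ ψ F U : ℝ → ℝ} (hμ : Continuous μ) (hμ0 : ∀ x, 0 < μ x)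
    (hmono : MonotoneOn μ (Icc 0 1)) (hψ : Continuous ψ) (hψ0 : ∀ x, 0 ≤ ψ x) {Q : ℝ} (hψ1 : ∀ x, ψ x ≤ Q)
    (hF : Continuous F) (hF0 : ∀ x, 0 ≤ F x) {A : ℝ} (hFA : ∀ x, F x ≤ A) (hFm : Monotone F)
    (hU : Continuous U) (hU0 : ∀ x, 0 ≤ U x)
    (hTU : ∀ x, TOp μ (fun s => ψ s * F (U s)) x ≤ U x) :
    ∃ u : ℝ → ℝ, Continuous u ∧ (∀ x, 0 ≤ u x) ∧ (∀ x, u x ≤ U x) ∧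
      ∀ x, u x = TOp μ (fun s => ψ s * F (u s)) x := by
  have hA : 0 ≤ A := (hF0 0).trans (hFA 0)
  have hQ : 0 ≤ Q := (hψ0 0).trans (hψ1 0)
  have hQA := mul_nonneg hQ hA
  let S : (ℝ → ℝ) → (ℝ → ℝ) := fun u => TOp μ (fun s => ψ s * F (u s))
  have b0 : ∀ u : ℝ → ℝ, ∀ x, 0 ≤ ψ x * F (u x) := fun u x => mul_nonneg (hψ0 _) (hF0 _)
  have b1 : ∀ u : ℝ → ℝ, ∀ x, ψ x * F (u x) ≤ Q * A := fun u x =>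
    mul_le_mul (hψ1 _) (hFA _) (hF0 _) hQ
  have hSlip : ∀ u, Continuous u → ∀ r s, |S u r - S u s| ≤ Q * A * |r - s| := fun u hu r s =>
    TOp_lip hμ hμ0 hmono (by fun_prop) hQA (b0 u) (b1 u) r s
  have lipc : ∀ v : ℝ → ℝ, (∀ r s, |v r - v s| ≤ Q * A * |r - s|) → Continuous v := fun v hv =>
    (LipschitzWith.of_dist_le_mul (K := ⟨Q * A, hQA⟩) (fun x y => hv x y)).continuous
  have hSmono : ∀ u v, Continuous u → Continuous v → (∀ x, u x ≤ v x) → ∀ x, S u x ≤ S v x :=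
    fun u v hu hv huv x => TOp_mono hμ hμ0 (by fun_prop) (by fun_prop)
      (fun y => mul_le_mul_of_nonneg_left (hFm (huv y)) (hψ0 y)) x
  let seq : ℕ → ℝ → ℝ := fun n => S^[n] (fun _ => 0)
  have hs : ∀ n, seq (n+1) = S (seq n) := fun n => Function.iterate_succ_apply' S n _
  have hc : ∀ n, Continuous (seq n) := by
    intro n
    induction n with
    | zero => exact continuous_const
    | succ n ih => rw [hs]; exact lipc _ (hSlip _ ih)
  have hstep : ∀ n x, seq n x ≤ seq (n+1) x := by
    intro n
    induction n with
    | zero => intro x; rw [hs]; exact TOp_nonneg hμ0 (b0 _) x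
    | succ n ih => intro x; rw [hs (n+1), hs n]; exact hSmono _ _ (hc _) (by rw [← hs]; exact hc _) (by intro y; rw [← hs]; exact ih y) x
  have hle : ∀ n x, seq n x ≤ U x := by
    intro n
    induction n with
    | zero => exact hU0
    | succ n ih => intro x; rw [hs]; exact (hSmono _ _ (hc _) hU ih x).trans (hTU x)
  have hm : ∀ x, Monotone (fun n => seq n x) := fun x => monotone_nat_of_le_succ (fun n => hstep n x)
  have hbdd : ∀ x, BddAbove (range fun n => seq n x) := fun x => ⟨U x, by rintro _ ⟨n, rfl⟩; exact hle n x⟩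
  let u : ℝ → ℝ := fun x => ⨆ n, seq n x
  have hlim : ∀ x, Tendsto (fun n => seq n x) atTop (nhds (u x)) := fun x =>
    tendsto_atTop_ciSup (hm x) (hbdd x)
  have hlim' : ∀ x, Tendsto (fun n => seq (n+1) x) atTop (nhds (u x)) := fun x =>
    (hlim x).comp (tendsto_add_atTop_nat 1)
  have huc : Continuous u := by
    apply lipc
    intro r s
    refine le_of_tendsto (((hlim' r).sub (hlim' s)).abs) (Eventually.of_forall fun n => ?_)
    simp only [hs]; exact hSlip _ (hc n) r s
  refine ⟨u, huc, fun x => ge_of_tendsto (hlim x) (Eventually.of_forall fun n => hm x (Nat.zero_le n)),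
    fun x => le_of_tendsto (hlim x) (Eventually.of_forall fun n => hle n x), fun x => ?_⟩
  have h1 : Tendsto (fun n => S (seq n) x) atTop (nhds (S u x)) := by
    apply TOp_tendsto hμ hμ0 hmono (fun n => ?_) hQA (fun n => b0 _) (fun n => b1 _)
    · intro y
      exact ((hF.tendsto _).comp (hlim y)).const_mul _
    · have := hc n; fun_prop
  have h2 := hlim' x
  simp only [hs] at h2
  exact tendsto_nhds_unique h2 h1

lemma primitive_hasDeriv {k : ℝ → ℝ} (hk : Continuous k) (r : ℝ) :
    HasDerivAt (fun r => ∫ s in (0:ℝ)..r, k s) (k r) r :=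
  intervalIntegral.integral_hasDerivAt_right (hk.intervalIntegrable _ _)
    (hk.stronglyMeasurableAtFilter _ _) hk.continuousAt

lemma mu_hasDeriv {α : ℝ} {phi' μ : ℝ → ℝ} (hphi : Continuous phi')
    (hμdef : ∀ r, μ r = Real.exp (α * ∫ s in (0:ℝ)..r, s * phi' s)) (r : ℝ) :
    HasDerivAt μ (μ r * (α * (r * phi' r))) r := by
  have h1 : HasDerivAt (fun r => ∫ s in (0:ℝ)..r, s * phi' s) (r * phi' r) r :=
    primitive_hasDeriv (k := fun s => s * phi' s) (by fun_prop) r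
  have h2 := (h1.const_mul α).exp
  rw [hμdef r]
  have : μ = fun r => Real.exp (α * ∫ s in (0:ℝ)..r, s * phi' s) := funext hμdef
  rw [this]; exact h2

/-- From a fixed point of the integral operator to a classical solution. -/
lemma isSolution_of_fixed (D : GelfandData) {α lam : ℝ} (hlam : 0 < lam) {phi' psi' F μ u : ℝ → ℝ}
    (hphi : Continuous phi') (hpsi : Continuous psi') (hF : Continuous F)
    (hphie : ∀ r ∈ Icc (0:ℝ) 1, phi' r = D.phi r) (hpsie : ∀ r ∈ Icc (0:ℝ) 1, psi' r = D.psi r)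
    (hpsi0 : ∀ r, 0 ≤ psi' r) (hF0 : ∀ r, 0 < F r)
    (hμdef : ∀ r, μ r = Real.exp (α * ∫ s in (0:ℝ)..r, s * phi' s))
    (hu : Continuous u)
    (hFu : ∀ r ∈ Icc (0:ℝ) 1, F (u r) = D.f (u r))
    (hfix : ∀ r, u r = TOp μ (fun s => lam * psi' s * F (u s)) r) :
    ∃ v, IsSolution D α lam v ∧ v 0 = u 0 := by
  set h : ℝ → ℝ := fun s => lam * psi' s * F (u s) with hh
  have hhc : Continuous h := by fun_prop
  have hh0 : ∀ x, 0 ≤ h x := fun x => mul_nonneg (mul_nonneg hlam.le (hpsi0 x)) (hF0 _).le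
  have hμ0 : ∀ x, 0 < μ x := fun x => by rw [hμdef]; exact Real.exp_pos _
  have hμd : ∀ r, HasDerivAt μ (μ r * (α * (r * phi' r))) r := mu_hasDeriv hphi hμdef
  have hμ : Continuous μ := continuous_iff_continuousAt.2 fun r => (hμd r).continuousAt
  have hpc : Continuous (pOp μ h) := pOp_cont hμ hμ0 hhc
  let v : ℝ → ℝ := fun r => ∫ t in r..1, pOp μ h t
  have hvd : ∀ r, HasDerivAt v (-(pOp μ h r)) r := fun r =>
    intervalIntegral.integral_hasDerivAt_left (hpc.intervalIntegrable _ _)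
      (hpc.stronglyMeasurableAtFilter _ _) hpc.continuousAt
  have hvd' : deriv v = fun r => -(pOp μ h r) := funext fun r => (hvd r).deriv
  have huv : ∀ r ∈ Icc (0:ℝ) 1, v r = u r := by
    intro r hr
    rw [hfix r]; unfold TOp; rw [clampU_eq hr]
  have hv1 : ContDiff ℝ 1 v := by
    rw [contDiff_one_iff_deriv]
    exact ⟨fun r => (hvd r).differentiableAt, by rw [hvd']; exact hpc.neg⟩
  have hdw : ∀ r ∈ Icc (0:ℝ) 1, derivWithin v (Icc 0 1) r = -(pOp μ h r) := fun r hr =>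
    (hvd r).hasDerivWithinAt.derivWithin (uniqueDiffOn_Icc (by norm_num) r hr)
  have hHd : ∀ r, HasDerivAt (fun r => ∫ s in (0:ℝ)..r, s * h s * μ s) (r * h r * μ r) r := fun r =>
    (intervalIntegral.integral_hasDerivAt_right (Continuous.intervalIntegrable (by fun_prop) _ _)
        (Continuous.stronglyMeasurableAtFilter (by fun_prop) _ _) (Continuous.continuousAt (by fun_prop)))
  have hpd : ∀ r, 0 < r → HasDerivAt (pOp μ h) (h r - (1 / r + α * r * phi' r) * pOp μ h r) r := by
    intro r hr
    have h1 : HasDerivAt (fun r => (∫ s in (0:ℝ)..r, s * h s * μ s) / (r * μ r)) _ r :=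
      (hHd r).div ((hasDerivAt_id r).mul (hμd r)) (mul_pos hr (hμ0 r)).ne'
    have h2 : (fun r => (∫ s in (0:ℝ)..r, s * h s * μ s) / (r * μ r)) =ᶠ[nhds r] pOp μ h := by
      filter_upwards [lt_mem_nhds hr] with x hx
      exact (pOp_eq hx.ne').symm
    refine (h1.congr_of_eventuallyEq h2.symm).congr_deriv ?_
    rw [pOp_eq hr.ne']
    have := (hμ0 r).ne'
    simp only [id]
    field_simp
  have hpos : ∀ t, 0 < t → 0 < pOp μ h t := by
    intro t ht
    unfold pOp
    refine mul_pos (div_pos ht (hμ0 t)) ?_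
    have hψp : ∀ᶠ x in nhdsWithin (0:ℝ) (Ioi 0), 0 < psi' (t * x) := by
      have hc : ContinuousAt (fun x => psi' (t * x)) 0 := Continuous.continuousAt (by fun_prop)
      refine (hc.eventually_const_lt ?_).filter_mono nhdsWithin_le_nhds
      show 0 < psi' (t * 0)
      rw [mul_zero, hpsie 0 (by simp), D.psi_zero]; norm_num
    obtain ⟨x, hx1, hx2, hx3⟩ := (hψp.and ((Ioo_mem_nhdsGT (show (0:ℝ) < 1 by norm_num)))).exists
    apply intervalIntegral.integral_pos (by norm_num) (Continuous.continuousOn (by fun_prop))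
    · intro y hy
      exact mul_nonneg (mul_nonneg hy.1.le (hh0 _)) (hμ0 _).le
    · exact ⟨x, ⟨hx2.le, hx3.le⟩, mul_pos (mul_pos hx2 (mul_pos (mul_pos hlam hx1) (hF0 _))) (hμ0 _)⟩
  refine ⟨v, ⟨hv1.contDiffOn, ?_, ?_, ?_, ?_, ?_⟩, huv 0 (by simp)⟩
  · have h2 : ContDiffOn ℝ (1 + 1) v (Ioo 0 1) := by
      rw [contDiffOn_succ_iff_deriv_of_isOpen isOpen_Ioo]
      refine ⟨fun r _ => (hvd r).differentiableAt.differentiableWithinAt, by simp, ?_⟩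
      rw [hvd']
      refine ContDiffOn.neg ?_
      have := (contDiffOn_succ_iff_deriv_of_isOpen (𝕜 := ℝ) (n := 0) (f := pOp μ h) (isOpen_Ioo (a := (0:ℝ)) (b := 1))).2
      rw [zero_add] at this
      apply this
      refine ⟨fun r hr => (hpd r hr.1).differentiableAt.differentiableWithinAt, by simp, ?_⟩
      rw [contDiffOn_zero]
      have hcc : ContinuousOn (fun r => h r - (1 / r + α * r * phi' r) * pOp μ h r) (Ioo 0 1) := by
        refine hhc.continuousOn.sub (ContinuousOn.mul (ContinuousOn.add ?_ ?_) hpc.continuousOn)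
        · exact continuousOn_const.div continuousOn_id (fun x hx => hx.1.ne')
        · exact Continuous.continuousOn (by fun_prop)
      exact hcc.congr fun r hr => (hpd r hr.1).deriv
    have e : (1:WithTop ℕ∞) + 1 = 2 := by norm_num
    rwa [e] at h2
  · intro r hr
    apply intervalIntegral.intervalIntegral_pos_of_pos_on (hpc.intervalIntegrable _ _) _ hr.2
    intro x hx
    exact hpos x (hr.1.trans_lt hx.1)
  · rw [hdw 0 (by simp)]; simp [pOp]
  · simp [v]
  · intro r hr
    have hr' : r ∈ Icc (0:ℝ) 1 := ⟨hr.1.le, hr.2.le⟩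
    rw [derivWithin_congr (f := fun r => -(pOp μ h r)) (fun x hx => hdw x ⟨hx.1.le, hx.2.le⟩) (hdw r hr'),
      (((hpd r hr.1).fun_neg).hasDerivWithinAt).derivWithin (isOpen_Ioo.uniqueDiffOn r hr), hdw r hr', huv r hr',
      ← hFu r hr', ← hphie r hr', ← hpsie r hr']
    simp only [hh]
    ring

/-- Inverse of the primitive of `1 / F`. -/
lemma exists_inv {F : ℝ → ℝ} {A : ℝ} (hF : Continuous F) (hF0 : ∀ x, 0 < F x) (hFA : ∀ x, F x ≤ A) :
    ∃ Gi : ℝ → ℝ, Continuous Gi ∧ StrictMono Gi ∧ (∀ x, Gi (∫ s in (0:ℝ)..x, 1 / F s) = x) ∧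
      ∀ y, HasDerivAt Gi (F (Gi y)) y := by
  have hA : 0 < A := (hF0 0).trans_le (hFA 0)
  have hc : Continuous (fun s => 1 / F s) := continuous_const.div hF (fun x => (hF0 x).ne')
  let G : ℝ → ℝ := fun x => ∫ s in (0:ℝ)..x, 1 / F s
  have hGd : ∀ x, HasDerivAt G (1 / F x) x := primitive_hasDeriv hc
  have hG0 : G 0 = 0 := by simp [G]
  have hGc : Continuous G := continuous_iff_continuousAt.2 fun r => (hGd r).continuousAt
  have hGm : StrictMono G := strictMono_of_deriv_pos fun x => by
    rw [(hGd x).deriv]; exact div_pos one_pos (hF0 x)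
  have hd : ∀ x, HasDerivAt (fun x => G x - x / A) (1 / F x - 1 / A) x := fun x =>
    (hGd x).sub ((hasDerivAt_id x).div_const A)
  have hmm : Monotone (fun x => G x - x / A) := by
    apply monotone_of_deriv_nonneg
    · exact fun x => (hd x).differentiableAt
    · intro x
      rw [(hd x).deriv, sub_nonneg]
      exact one_div_le_one_div_of_le (hF0 x) (hFA x)
  have hsurj : Function.Surjective G := by
    apply hGc.surjective
    · refine tendsto_atTop_mono' _ ?_ (tendsto_id.atTop_div_const hA)
      filter_upwards [eventually_ge_atTop 0] with x hx
      have := hmm hx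
      simp [hG0] at this; exact this
    · refine tendsto_atBot_mono' _ ?_ (tendsto_id.atBot_div_const hA)
      filter_upwards [eventually_le_atBot 0] with x hx
      have := hmm hx
      simp [hG0] at this; exact this
  let e := StrictMono.orderIsoOfSurjective G hGm hsurj
  have he : ∀ y, G (e.symm y) = y := fun y => e.apply_symm_apply y
  refine ⟨e.symm, e.symm.continuous, e.symm.strictMono, fun x => e.symm_apply_apply x, fun y => ?_⟩
  have := HasDerivAt.of_local_left_inverse (f := G) (g := e.symm) (a := y) e.symm.continuous.continuousAt
    (hGd (e.symm y)) (div_pos one_pos (hF0 _)).ne' (Eventually.of_forall he)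
  simpa using this

lemma super_of_g {lam B w A : ℝ} {psi' F F' μ g g' : ℝ → ℝ}
    (hpsi : Continuous psi') 
    (hμ : Continuous μ) (hμ0 : ∀ x, 0 < μ x)
    (hF : Continuous F) (hF0 : ∀ x, 0 < F x) (hFA : ∀ x, F x ≤ A)
    (hFd : ∀ x ∈ Ioo 0 w, HasDerivAt F (F' x) x) (hFB : ∀ x ∈ Ioo 0 w, F' x ≤ B)
    (hg : ContinuousOn g (Ico 0 1)) (hg0 : g 0 = 0) (hgpos : ∀ r ∈ Ioo (0:ℝ) 1, 0 < g r)
    (hgd : ∀ r ∈ Ioo (0:ℝ) 1, HasDerivAt g (g' r) r)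
    (hgi : ∀ r ∈ Ioo (0:ℝ) 1, r * (lam * psi' r) * μ r + B * (g r)^2 / (r * μ r) ≤ g' r)
    (hint : IntervalIntegrable (fun r => g r / (r * μ r)) volume 0 1)
    (hle : ∫ r in (0:ℝ)..1, g r / (r * μ r) ≤ ∫ s in (0:ℝ)..w, 1 / F s) :
    ∃ U : ℝ → ℝ, Continuous U ∧ (∀ x, 0 ≤ U x) ∧ (∀ x, U x ≤ w) ∧
      ∀ x, TOp μ (fun s => lam * psi' s * F (U s)) x ≤ U x := by
  obtain ⟨Gi, hGic, hGim, hGiG, hGid⟩ := exists_inv hF hF0 hFA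
  have hGi0 : Gi 0 = 0 := by simpa using hGiG 0
  set q : ℝ → ℝ := fun r => g r / (r * μ r) with hq
  have hqc : ∀ r ∈ Ioo (0:ℝ) 1, ContinuousAt q r := by
    intro r hr
    exact ((hgd r hr).continuousAt).div (continuousAt_id.mul hμ.continuousAt) (mul_pos hr.1 (hμ0 r)).ne'
  have hqpos : ∀ r ∈ Ioo (0:ℝ) 1, 0 < q r := fun r hr => div_pos (hgpos r hr) (mul_pos hr.1 (hμ0 r))
  have hsub : ∀ a ∈ Icc (0:ℝ) 1, ∀ b ∈ Icc (0:ℝ) 1, IntervalIntegrable q volume a b := by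
    intro a ha b hb
    apply hint.mono_set
    rw [uIcc_of_le (zero_le_one' ℝ)]
    exact uIcc_subset_Icc ha hb
  let v : ℝ → ℝ := fun r => ∫ t in r..1, q t
  have hvc : ContinuousOn v (Icc 0 1) := by
    have := intervalIntegral.continuousOn_primitive_interval_left (μ := volume) (f := q) (a := 0) (b := 1)
      (by rw [uIcc_of_le (zero_le_one' ℝ), integrableOn_Icc_iff_integrableOn_Ioc]
          exact (intervalIntegrable_iff_integrableOn_Ioc_of_le (zero_le_one' ℝ)).1 hint)
    rwa [uIcc_of_le (zero_le_one' ℝ)] at this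
  have hvd : ∀ r ∈ Ioo (0:ℝ) 1, HasDerivAt v (-(q r)) r := by
    intro r hr
    refine intervalIntegral.integral_hasDerivAt_left (hsub r ⟨hr.1.le, hr.2.le⟩ 1 (by simp)) ?_ (hqc r hr)
    exact ContinuousAt.stronglyMeasurableAtFilter isOpen_Ioo hqc r hr
  have hvanti : StrictAntiOn v (Icc 0 1) := by
    apply strictAntiOn_of_deriv_neg (convex_Icc 0 1) hvc
    intro r hr
    rw [interior_Icc] at hr
    rw [(hvd r hr).deriv]; linarith [hqpos r hr]
  have hv1 : v 1 = 0 := by simp [v]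
  let U : ℝ → ℝ := fun r => Gi (v (clampU r))
  have hUc : Continuous U := hGic.comp (hvc.comp_continuous clampU_cont clampU_mem)
  have hUe : ∀ r ∈ Icc (0:ℝ) 1, U r = Gi (v r) := fun r hr => by simp only [U]; rw [clampU_eq hr]
  have hv0 : Gi (v 0) ≤ w := by rw [← hGiG w]; exact hGim.monotone hle
  have hU0 : ∀ x, 0 ≤ U x := by
    intro x
    rw [← hGi0, ← hv1]
    exact hGim.monotone (hvanti.antitoneOn (clampU_mem x) (by simp) (clampU_mem x).2)
  have hUw : ∀ x, U x ≤ w := by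
    intro x
    exact (hGim.monotone (hvanti.antitoneOn (by simp) (clampU_mem x) (clampU_mem x).1)).trans hv0
  have hUI : ∀ r ∈ Ioo (0:ℝ) 1, U r ∈ Ioo 0 w := by
    intro r hr
    have hr' : r ∈ Icc (0:ℝ) 1 := ⟨hr.1.le, hr.2.le⟩
    rw [hUe r hr']
    constructor
    · rw [← hGi0, ← hv1]
      exact hGim (hvanti hr' (by simp) hr.2)
    · exact (hGim (hvanti (by simp) hr' hr.1)).trans_le hv0
  have hUd : ∀ r ∈ Ioo (0:ℝ) 1, HasDerivAt U (F (U r) * -(q r)) r := by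
    intro r hr
    have hr' : r ∈ Icc (0:ℝ) 1 := ⟨hr.1.le, hr.2.le⟩
    have h1 : HasDerivAt (fun r => Gi (v r)) (F (Gi (v r)) * -(q r)) r := (hGid (v r)).comp r (hvd r hr)
    rw [hUe r hr']
    refine h1.congr_of_eventuallyEq ?_
    filter_upwards [Ioo_mem_nhds hr.1 hr.2] with x hx
    exact hUe x ⟨hx.1.le, hx.2.le⟩
  set h : ℝ → ℝ := fun s => lam * psi' s * F (U s) with hh
  have hhc : Continuous h := by fun_prop
  have hpc := pOp_cont hμ hμ0 hhc
  let H : ℝ → ℝ := fun r => ∫ s in (0:ℝ)..r, s * h s * μ s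
  have hHd : ∀ r, HasDerivAt H (r * h r * μ r) r := fun r =>
    primitive_hasDeriv (k := fun s => s * h s * μ s) (by fun_prop) r
  have hHc : Continuous H := continuous_iff_continuousAt.2 fun r => (hHd r).continuousAt
  have hΦ : MonotoneOn (fun r => F (U r) * g r - H r) (Ico 0 1) := by
    apply monotoneOn_of_deriv_nonneg (convex_Ico 0 1)
    · exact ((hF.comp hUc).continuousOn.mul hg).sub hHc.continuousOn
    · intro r hr
      rw [interior_Ico] at hr
      exact ((((hFd _ (hUI r hr)).comp r (hUd r hr)).mul (hgd r hr)).sub (hHd r)).differentiableAt.differentiableWithinAt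
    · intro r hr
      rw [interior_Ico] at hr
      have hd := ((((hFd _ (hUI r hr)).comp r (hUd r hr)).mul (hgd r hr)).sub (hHd r)).deriv
      have e : (fun r => F (U r) * g r - H r) = ((F ∘ U) * g - H) := rfl
      rw [e, hd]
      have h1 := hgi r hr
      have h2 := hFB _ (hUI r hr)
      have hrμ := mul_pos hr.1 (hμ0 r)
      have h3 : F' (U r) * (g r)^2 / (r * μ r) ≤ B * (g r)^2 / (r * μ r) := by gcongr
      have h4 := mul_nonneg (hF0 (U r)).le (show 0 ≤ g' r - r * (lam * psi' r) * μ r - F' (U r) * (g r)^2 / (r * μ r) by linarith)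
      have h5 : F' (U r) * (F (U r) * -q r) * g r + F (U r) * g' r - r * h r * μ r
        = F (U r) * (g' r - r * (lam * psi' r) * μ r - F' (U r) * (g r)^2 / (r * μ r)) := by
        simp only [hq, hh]; field_simp; ring
      simp only [Function.comp]
      rw [h5]; exact h4
  have hΦ0 : ∀ r ∈ Ioo (0:ℝ) 1, H r ≤ F (U r) * g r := by
    intro r hr
    have := hΦ (show (0:ℝ) ∈ Ico (0:ℝ) 1 by simp) ⟨hr.1.le, hr.2⟩ hr.1.le
    simp only [hg0, H] at this
    simp at this
    exact this
  have hD : AntitoneOn (fun r => U r - ∫ t in r..1, pOp μ h t) (Icc 0 1) := by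
    have hd : ∀ r ∈ Ioo (0:ℝ) 1, HasDerivAt (fun r => U r - ∫ t in r..1, pOp μ h t)
        (F (U r) * -(q r) - (-(pOp μ h r))) r := fun r hr =>
      (hUd r hr).sub (intervalIntegral.integral_hasDerivAt_left (hpc.intervalIntegrable _ _)
      (hpc.stronglyMeasurableAtFilter _ _) hpc.continuousAt)
    apply antitoneOn_of_deriv_nonpos (convex_Icc 0 1)
    · refine hUc.continuousOn.sub (Continuous.continuousOn ?_)
      exact continuous_iff_continuousAt.2 fun r => (intervalIntegral.integral_hasDerivAt_left (hpc.intervalIntegrable _ _)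
      (hpc.stronglyMeasurableAtFilter _ _) hpc.continuousAt).continuousAt
    · intro r hr
      rw [interior_Icc] at hr
      exact (hd r hr).differentiableAt.differentiableWithinAt
    · intro r hr
      rw [interior_Icc] at hr
      rw [(hd r hr).deriv, pOp_eq hr.1.ne']
      have hrμ := mul_pos hr.1 (hμ0 r)
      have : H r / (r * μ r) ≤ F (U r) * g r / (r * μ r) := by
        have := hΦ0 r hr
        gcongr
      simp only [hq, H] at this ⊢
      rw [mul_div_assoc] at this
      linarith
  refine ⟨U, hUc, hU0, hUw, fun x => ?_⟩
  have h1 := hD (clampU_mem x) (show (1:ℝ) ∈ Icc (0:ℝ) 1 by simp) (clampU_mem x).2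
  have hU1 : U 1 = 0 := by rw [hUe 1 (by simp), hv1, hGi0]
  have hUcl : U (clampU x) = U x := by simp only [U]; rw [clampU_eq (clampU_mem x)]
  simp only [hU1, intervalIntegral.integral_same, hUcl] at h1
  unfold TOp
  linarith

set_option maxHeartbeats 2000000 in
lemma exists_g {α lam B phi0 M1 C1 θ m : ℝ} {phi' psi' μ M : ℝ → ℝ}
    (hα : 1 ≤ α) (hlam : 0 < lam) (hB : 0 < B)
    (hphi : Continuous phi') (hphi0 : ∀ r, 0 ≤ phi' r) (hphi1 : ∀ r, phi' r ≤ 1)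
    (hphip : ∀ r ∈ Ico (0:ℝ) 1, 0 < phi' r)
    (hμdef : ∀ r, μ r = Real.exp (α * ∫ s in (0:ℝ)..r, s * phi' s))
    (hM : ContinuousOn M (Ico 0 1)) (hMm : MonotoneOn M (Ico 0 1)) (hM1 : ∀ r ∈ Ico (0:ℝ) 1, 1 ≤ M r)
    (hMi : IntervalIntegrable M volume 0 1)
    (hψ : ∀ r ∈ Ioo (0:ℝ) 1, psi' r ≤ M r * phi' r)
    (hp0 : 0 < phi0) (hp : ∀ r ∈ Icc (0:ℝ) (1/2), phi0 ≤ phi' r)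
    (hMM : ∀ r ∈ Icc (0:ℝ) (1/2), M r ≤ M1)
    (hC1 : ∀ r ∈ Ioo (0:ℝ) 1, M r / r ≤ 1 / r + C1 * M r) (hC1' : 0 ≤ C1)
    (hm : m = ∫ r in (0:ℝ)..1, M r)
    (hθ : θ = 8 * (B * (lam / α)) * M1 / phi0) (hθ1 : θ ≤ 1) (hE : 8 * (B * (lam / α)) * m ≤ 1/2) :
    ∃ g g' : ℝ → ℝ, ContinuousOn g (Ico 0 1) ∧ g 0 = 0 ∧ (∀ r ∈ Ioo (0:ℝ) 1, 0 < g r) ∧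
      (∀ r ∈ Ioo (0:ℝ) 1, HasDerivAt g (g' r) r) ∧
      (∀ r ∈ Ioo (0:ℝ) 1, r * (lam * psi' r) * μ r + B * (g r)^2 / (r * μ r) ≤ g' r) ∧
      IntervalIntegrable (fun r => g r / (r * μ r)) volume 0 1 ∧
      ∫ r in (0:ℝ)..1, g r / (r * μ r) ≤
        lam / α * ((1 + θ) * (1 + 16 * (B * (lam / α)) * m)) * (Real.log α / 2 + 1 / 4 + C1 * m) := by
  have hα0 : 0 < α := by linarith
  set x := lam / α with hx
  have hx0 : 0 < x := div_pos hlam hα0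
  have hxα : x * α = lam := by rw [hx]; field_simp
  set b := B * x with hb
  have hb0 : 0 < b := mul_pos hB hx0
  have hM1' : 1 ≤ M1 := (hM1 0 (by simp)).trans (hMM 0 (by simp))
  have hθ0 : 0 ≤ θ := by rw [hθ]; positivity
  have hμd := mu_hasDeriv hphi hμdef
  have hμ : Continuous μ := continuous_iff_continuousAt.2 fun r => (hμd r).continuousAt
  have hμ0 : ∀ r, 0 < μ r := fun r => by rw [hμdef]; exact Real.exp_pos _
  have hμzero : μ 0 = 1 := by rw [hμdef]; simp
  -- elementary bounds on μ
  have hy0 : ∀ r, 0 ≤ r → 0 ≤ ∫ s in (0:ℝ)..r, s * phi' s := fun r hr =>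
    intervalIntegral.integral_nonneg hr (fun s hs => mul_nonneg hs.1 (hphi0 s))
  have hy1 : ∀ r, 0 ≤ r → ∫ s in (0:ℝ)..r, s * phi' s ≤ r^2/2 := by
    intro r hr
    have : ∫ s in (0:ℝ)..r, s * phi' s ≤ ∫ s in (0:ℝ)..r, s := by
      apply intervalIntegral.integral_mono_on hr
      · exact Continuous.intervalIntegrable (by fun_prop) _ _
      · exact Continuous.intervalIntegrable (by fun_prop) _ _
      · intro s hs
        nlinarith [hs.1, hphi1 s]
    rw [integral_id] at this
    linarith
  have hμ1 : ∀ r, 0 ≤ r → 1 ≤ μ r := by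
    intro r hr
    rw [hμdef]; exact Real.one_le_exp (mul_nonneg hα0.le (hy0 r hr))
  have hμ2 : ∀ r, 0 ≤ r → μ r - 1 ≤ μ r * (α * r^2/2) := by
    intro r hr
    have h1 := Real.add_one_le_exp (-(α * ∫ s in (0:ℝ)..r, s * phi' s))
    have h2 : μ r * Real.exp (-(α * ∫ s in (0:ℝ)..r, s * phi' s)) = 1 := by
      rw [hμdef, ← Real.exp_add]; simp
    have h3 := mul_le_mul_of_nonneg_left h1 (hμ0 r).le
    have h4 := mul_le_mul_of_nonneg_left (mul_le_mul_of_nonneg_left (hy1 r hr) hα0.le) (hμ0 r).le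
    rw [h2] at h3
    nlinarith
  let k : ℝ → ℝ := fun s => M s * (s * phi' s * μ s)
  have hki : IntervalIntegrable k volume 0 1 :=
    hMi.mul_continuousOn (Continuous.continuousOn (by fun_prop))
  have hkc : ContinuousOn k (Ico 0 1) := hM.mul (Continuous.continuousOn (by fun_prop))
  let P : ℝ → ℝ := fun r => ∫ s in (0:ℝ)..r, k s
  let Q : ℝ → ℝ := fun r => ∫ s in (0:ℝ)..r, M s
  have key : ∀ h : ℝ → ℝ, IntervalIntegrable h volume 0 1 → ContinuousOn h (Ico 0 1) →
      (∀ r ∈ Icc (0:ℝ) 1, IntervalIntegrable h volume 0 r) ∧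
      (∀ r ∈ Icc (0:ℝ) 1, IntervalIntegrable h volume r 1) ∧
      ContinuousOn (fun r => ∫ s in (0:ℝ)..r, h s) (Icc 0 1) ∧
      ∀ r ∈ Ioo (0:ℝ) 1, HasDerivAt (fun r => ∫ s in (0:ℝ)..r, h s) (h r) r := by
    intro h hi hc
    have hsub : ∀ a ∈ Icc (0:ℝ) 1, ∀ b ∈ Icc (0:ℝ) 1, IntervalIntegrable h volume a b := by
      intro a ha b hb
      apply hi.mono_set
      rw [uIcc_of_le (zero_le_one' ℝ)]
      exact uIcc_subset_Icc ha hb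
    have hca : ∀ r ∈ Ioo (0:ℝ) 1, ContinuousAt h r := fun r hr =>
      hc.continuousAt (Ico_mem_nhds hr.1 hr.2)
    refine ⟨fun r hr => hsub 0 (by simp) r hr, fun r hr => hsub r hr 1 (by simp), ?_, fun r hr => ?_⟩
    · have := intervalIntegral.continuousOn_primitive_interval (μ := volume) (f := h) (a := 0) (b := 1)
        (by rw [uIcc_of_le (zero_le_one' ℝ), integrableOn_Icc_iff_integrableOn_Ioc]
            exact (intervalIntegrable_iff_integrableOn_Ioc_of_le (zero_le_one' ℝ)).1 hi)
      rwa [uIcc_of_le (zero_le_one' ℝ)] at this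
    · exact intervalIntegral.integral_hasDerivAt_right (hsub 0 (by simp) r ⟨hr.1.le, hr.2.le⟩)
        (ContinuousAt.stronglyMeasurableAtFilter isOpen_Ioo hca r hr) (hca r hr)
  obtain ⟨hki0, -, hPc, hPd⟩ := key k hki hkc
  obtain ⟨hMi0, hMi1, hQc, hQd⟩ := key M hMi hM
  have hI : ∀ r ∈ Ioo (0:ℝ) 1, r ∈ Ico (0:ℝ) 1 := fun r hr => ⟨hr.1.le, hr.2⟩
  have hQ0 : ∀ r ∈ Ico (0:ℝ) 1, 0 ≤ Q r := by
    intro r hr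
    apply intervalIntegral.integral_nonneg hr.1
    intro s hs
    linarith [hM1 s ⟨hs.1, hs.2.trans_lt hr.2⟩]
  have hQm : ∀ r ∈ Ico (0:ℝ) 1, Q r ≤ m := by
    intro r hr
    have hr' : r ∈ Icc (0:ℝ) 1 := ⟨hr.1, hr.2.le⟩
    rw [hm, ← intervalIntegral.integral_add_adjacent_intervals (hMi0 r hr') (hMi1 r hr')]
    have : ∫ s in r..1, (0:ℝ) ≤ ∫ s in r..1, M s := by
      apply intervalIntegral.integral_mono_on_of_le_Ioo hr.2.le (by simp) (hMi1 r hr')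
      intro s hs
      linarith [hM1 s ⟨hr.1.trans hs.1.le, hs.2⟩]
    simp at this
    simp only [Q]; linarith
  have hm0 : 0 ≤ m := (hQ0 0 (by simp)).trans (hQm 0 (by simp))
  have hPpos : ∀ r ∈ Ioo (0:ℝ) 1, 0 < P r := by
    intro r hr
    apply intervalIntegral.intervalIntegral_pos_of_pos_on (hki0 r ⟨hr.1.le, hr.2.le⟩) _ hr.1
    intro s hs
    have hs' : s ∈ Ico (0:ℝ) 1 := ⟨hs.1.le, hs.2.trans hr.2⟩
    exact mul_pos (by linarith [hM1 s hs']) (mul_pos (mul_pos hs.1 (hphip s hs')) (hμ0 s))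
  have hPle : ∀ r ∈ Ioo (0:ℝ) 1, P r ≤ M r * (μ r - 1) / α := by
    intro r hr
    have h1 : ∫ s in (0:ℝ)..r, s * phi' s * μ s = (μ r - 1) / α := by
      have := intervalIntegral.integral_eq_sub_of_hasDerivAt (f := fun s => μ s / α)
        (f' := fun s => s * phi' s * μ s) (a := 0) (b := r)
        (fun s _ => ((hμd s).div_const α).congr_deriv (by field_simp))
        (Continuous.intervalIntegrable (by fun_prop) _ _)
      rw [this, hμzero]; ring
    have h2 : P r ≤ ∫ s in (0:ℝ)..r, M r * (s * phi' s * μ s) := by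
      apply intervalIntegral.integral_mono_on hr.1.le (hki0 r ⟨hr.1.le, hr.2.le⟩)
      · exact Continuous.intervalIntegrable (by fun_prop) _ _
      · intro s hs
        apply mul_le_mul_of_nonneg_right (hMm ⟨hs.1, hs.2.trans_lt hr.2⟩ (hI r hr) hs.2)
        exact mul_nonneg (mul_nonneg hs.1 (hphi0 s)) (hμ0 s).le
    rw [intervalIntegral.integral_const_mul, h1] at h2
    rw [mul_div_assoc]; exact h2
  -- the exponential factor
  let e : ℝ → ℝ := fun r => Real.exp (8 * b * Q r)
  have he1 : ∀ r ∈ Ico (0:ℝ) 1, 1 ≤ e r := fun r hr =>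
    Real.one_le_exp (mul_nonneg (by positivity) (hQ0 r hr))
  have heκ : ∀ r ∈ Ico (0:ℝ) 1, e r ≤ 1 + 16 * b * m := by
    intro r hr
    have h1 : e r ≤ Real.exp (8 * b * m) :=
      Real.exp_le_exp.2 (mul_le_mul_of_nonneg_left (hQm r hr) (by positivity))
    have h2 : Real.exp (8 * b * m) ≤ 1 + 2 * (8 * b * m) := by
      have h3 := Real.add_one_le_exp (-(8 * b * m))
      have h4 : Real.exp (8 * b * m) * Real.exp (-(8 * b * m)) = 1 := by rw [← Real.exp_add]; simp
      have h5 := Real.exp_pos (8 * b * m)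
      have h6 : 0 ≤ 8 * b * m := by positivity
      generalize Real.exp (-(8 * b * m)) = E1 at *
      generalize Real.exp (8 * b * m) = E2 at *
      have h7 : E2 * (1 - 8 * b * m) ≤ 1 := by nlinarith
      have h8 : (1 + 2 * (8 * b * m)) * (1 - 8 * b * m) ≥ 1 := by nlinarith
      by_contra hcon
      push Not at hcon
      nlinarith
    linarith
  have he2 : ∀ r ∈ Ico (0:ℝ) 1, e r ≤ 2 := fun r hr => by
    have := heκ r hr; linarith
  have hed : ∀ r ∈ Ioo (0:ℝ) 1, HasDerivAt e (e r * (8 * b * M r)) r := fun r hr =>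
    ((hQd r hr).const_mul (8 * b)).exp
  let g : ℝ → ℝ := fun r => lam * (1 + θ) * (e r * P r)
  let g' : ℝ → ℝ := fun r => lam * (1 + θ) * (e r * (8 * b * M r) * P r + e r * k r)
  have hgpos : ∀ r ∈ Ioo (0:ℝ) 1, 0 < g r := fun r hr =>
    mul_pos (by positivity) (mul_pos (Real.exp_pos _) (hPpos r hr))
  have hgκ : ∀ r ∈ Ioo (0:ℝ) 1, g r ≤ x * ((1 + θ) * (1 + 16 * b * m)) * (M r * (μ r - 1)) := by
    intro r hr
    have h1 := mul_le_mul (heκ r (hI r hr)) (hPle r hr) (hPpos r hr).le (by positivity)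
    have h2 := mul_le_mul_of_nonneg_left h1 (show 0 ≤ lam * (1 + θ) by positivity)
    refine h2.trans (le_of_eq ?_)
    rw [hx]; field_simp
  have hg4 : ∀ r ∈ Ioo (0:ℝ) 1, g r ≤ 4 * x * (M r * (μ r - 1)) := by
    intro r hr
    refine (hgκ r hr).trans ?_
    have h1 : 0 ≤ M r * (μ r - 1) := mul_nonneg (by linarith [hM1 r (hI r hr)]) (by linarith [hμ1 r hr.1.le])
    refine mul_le_mul_of_nonneg_right ?_ h1
    have : (1 + θ) * (1 + 16 * b * m) ≤ 2 * 2 := mul_le_mul (by linarith) (by linarith) (by positivity) (by norm_num)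
    nlinarith
  have hgd : ∀ r ∈ Ioo (0:ℝ) 1, HasDerivAt g (g' r) r := fun r hr =>
    ((hed r hr).mul (hPd r hr)).const_mul _
  have hqle : ∀ r ∈ Ioo (0:ℝ) 1, g r / (r * μ r) ≤ x * ((1 + θ) * (1 + 16 * b * m)) * (1 / r + C1 * M r) ∧
      g r / (r * μ r) ≤ x * ((1 + θ) * (1 + 16 * b * m)) * (α * r / 2 + C1 * M r) := by
    intro r hr
    have hr0 := hr.1
    have hμr := hμ0 r
    set κ := x * ((1 + θ) * (1 + 16 * b * m))
    have hκ : 0 ≤ κ := by positivity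
    have hMr := hM1 r (hI r hr)
    have h0 : g r / (r * μ r) ≤ κ * (M r / r * ((μ r - 1) / μ r)) := by
      have : κ * (M r / r * ((μ r - 1) / μ r)) = κ * (M r * (μ r - 1)) / (r * μ r) := by field_simp
      rw [this]
      have := hgκ r hr
      gcongr
    have ht0 : 0 ≤ (μ r - 1) / μ r := div_nonneg (by linarith [hμ1 r hr.1.le]) hμr.le
    have ht1 : (μ r - 1) / μ r ≤ 1 := by rw [div_le_one hμr]; linarith
    have ht2 : (μ r - 1) / μ r ≤ α * r^2 / 2 := by rw [div_le_iff₀ hμr]; linarith [hμ2 r hr.1.le]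
    generalize (μ r - 1) / μ r = t at *
    have h1 := hC1 r hr
    have hMC : 0 ≤ C1 * M r := mul_nonneg hC1' (by linarith)
    have h2 : M r / r * t ≤ (1 / r + C1 * M r) * t := mul_le_mul_of_nonneg_right h1 ht0
    have h3 : 0 < 1 / r := by positivity
    constructor
    · refine h0.trans (mul_le_mul_of_nonneg_left ?_ hκ)
      nlinarith
    · refine h0.trans (mul_le_mul_of_nonneg_left ?_ hκ)
      have h4 : 1 / r * t ≤ α * r / 2 := by
        calc 1 / r * t ≤ 1 / r * (α * r^2 / 2) := mul_le_mul_of_nonneg_left ht2 h3.le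
          _ = _ := by field_simp
      nlinarith
  have hgc : ContinuousOn g (Ico 0 1) := by
    have h1 : ContinuousOn P (Ico 0 1) := hPc.mono Ico_subset_Icc_self
    have h2 : ContinuousOn Q (Ico 0 1) := hQc.mono Ico_subset_Icc_self
    exact continuousOn_const.mul (((continuousOn_const.mul h2).rexp).mul h1)
  have hint : IntervalIntegrable (fun r => g r / (r * μ r)) volume 0 1 := by
    have hdom : IntervalIntegrable (fun r => x * ((1 + θ) * (1 + 16 * b * m)) * (α * r / 2 + C1 * M r)) volume 0 1 :=
      ((Continuous.intervalIntegrable (by fun_prop) _ _).add (hMi.const_mul C1)).const_mul _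
    rw [intervalIntegrable_iff_integrableOn_Ioo_of_le (zero_le_one' ℝ)] at hdom ⊢
    refine Integrable.mono' hdom ?_ ?_
    · refine ContinuousOn.aestronglyMeasurable ?_ measurableSet_Ioo
      exact (hgc.mono Ioo_subset_Ico_self).div (continuousOn_id.mul hμ.continuousOn)
        (fun r hr => (mul_pos hr.1 (hμ0 r)).ne')
    · refine (ae_restrict_iff' measurableSet_Ioo).2 (Eventually.of_forall fun r hr => ?_)
      rw [Real.norm_eq_abs, abs_of_pos (div_pos (hgpos r hr) (mul_pos hr.1 (hμ0 r)))]
      exact (hqle r hr).2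
  refine ⟨g, g', hgc, by simp [g, P], hgpos, hgd, ?_, hint, ?_⟩
  · intro r hr
    have hr0 := hr.1
    have hrI := hI r hr
    have hμr := hμ0 r
    have hMr := hM1 r hrI
    have hφr := hphip r hrI
    have hgr := hgpos r hr
    have hg' : g' r = 8 * b * M r * g r + lam * (1 + θ) * (e r * k r) := by simp only [g, g']; ring
    have hk0 : 0 < k r := mul_pos (by linarith) (mul_pos (mul_pos hr0 hφr) hμr)
    have hk1 : lam * (1 + θ) * k r ≤ lam * (1 + θ) * (e r * k r) := by
      have := he1 r hrI
      apply mul_le_mul_of_nonneg_left _ (by positivity)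
      nlinarith
    have hk2 : r * (lam * psi' r) * μ r ≤ lam * k r := by
      have h1 := mul_le_mul_of_nonneg_left (hψ r hr) (show 0 ≤ lam * r * μ r by positivity)
      simp only [k]; nlinarith
    rw [hg']
    rcases le_total (1/2) r with h | h
    · have h1 : B * g r ^ 2 / (r * μ r) ≤ 8 * b * M r * g r := by
        rw [div_le_iff₀ (by positivity)]
        have h2 := hg4 r hr
        have h3 : B * g r ≤ 8 * b * M r * (r * μ r) := by
          have h4 : B * g r ≤ B * (4 * x * (M r * (μ r - 1))) := mul_le_mul_of_nonneg_left h2 hB.le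
          have h5 : B * (4 * x * (M r * (μ r - 1))) = 4 * b * M r * (μ r - 1) := by rw [hb]; ring
          have h6 : μ r - 1 ≤ 2 * (r * μ r) := by nlinarith
          have h7 := mul_le_mul_of_nonneg_left h6 (show 0 ≤ 4 * b * M r by positivity)
          linarith
        nlinarith
      have : 0 ≤ lam * θ * k r := by positivity
      linarith
    · have h1 : B * g r ^ 2 / (r * μ r) ≤ lam * θ * k r := by
        rw [div_le_iff₀ (by positivity)]
        have h2 := hg4 r hr
        have hd0 : 0 ≤ μ r - 1 := by linarith [hμ1 r hr0.le]
        have h3 : (μ r - 1)^2 ≤ μ r ^ 2 * (α * r^2/2) := by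
          have := hμ2 r hr0.le
          nlinarith
        have h4 : g r ^ 2 ≤ (4 * x * (M r * (μ r - 1)))^2 := by gcongr
        have h5 : B * g r ^ 2 ≤ B * (16 * x^2 * M r ^ 2 * (μ r ^ 2 * (α * r^2/2))) := by
          refine mul_le_mul_of_nonneg_left (h4.trans ?_) hB.le
          have := mul_le_mul_of_nonneg_left h3 (show 0 ≤ 16 * x^2 * M r ^ 2 by positivity)
          nlinarith
        have h6 : B * (16 * x^2 * M r ^ 2 * (μ r ^ 2 * (α * r^2/2)))
            = 8 * b * lam * M r * (r ^ 2 * μ r ^ 2) * M r := by rw [hb, ← hxα]; ring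
        have hri : r ∈ Icc (0:ℝ) (1/2) := ⟨hr0.le, h⟩
        have h7 : lam * θ * k r * (r * μ r) = 8 * b * lam * M r * (r ^ 2 * μ r ^ 2) * (M1 * (phi' r / phi0)) := by
          simp only [k, hθ]; field_simp
        rw [h7]
        rw [h6] at h5
        refine h5.trans (mul_le_mul_of_nonneg_left ?_ (by positivity))
        have h8 : 1 ≤ phi' r / phi0 := by rw [le_div_iff₀ hp0]; linarith [hp r hri]
        have h9 := hMM r hri
        nlinarith
      have : 0 ≤ 8 * b * M r * g r := by positivity
      linarith
  · set κ := x * ((1 + θ) * (1 + 16 * b * m)) with hκdef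
    have hκ : 0 ≤ κ := by positivity
    set a := 1 / Real.sqrt α with ha
    have hs1 : 1 ≤ Real.sqrt α := Real.one_le_sqrt.2 hα
    have ha0 : 0 < a := by positivity
    have ha1 : a ≤ 1 := by rw [ha, div_le_one (by positivity)]; exact hs1
    have haI : a ∈ Icc (0:ℝ) 1 := ⟨ha0.le, ha1⟩
    have hi0 : IntervalIntegrable (fun r => g r / (r * μ r)) volume 0 a :=
      hint.mono_set (by rw [uIcc_of_le (zero_le_one' ℝ)]; exact uIcc_subset_Icc (by simp) haI)
    have hi1 : IntervalIntegrable (fun r => g r / (r * μ r)) volume a 1 :=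
      hint.mono_set (by rw [uIcc_of_le (zero_le_one' ℝ)]; exact uIcc_subset_Icc haI (by simp))
    rw [← intervalIntegral.integral_add_adjacent_intervals hi0 hi1]
    have hinv : IntervalIntegrable (fun r:ℝ => 1 / r) volume a 1 := by
      apply ContinuousOn.intervalIntegrable
      rw [uIcc_of_le ha1]
      exact continuousOn_const.div continuousOn_id (fun r hr => (ha0.trans_le hr.1).ne')
    have hlin : IntervalIntegrable (fun r:ℝ => α * r / 2) volume 0 a :=
      Continuous.intervalIntegrable (by fun_prop) _ _
    have j0 : ∫ r in (0:ℝ)..a, g r / (r * μ r) ≤ ∫ r in (0:ℝ)..a, κ * (α * r / 2 + C1 * M r) := by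
      apply intervalIntegral.integral_mono_on_of_le_Ioo ha0.le hi0
        ((hlin.add ((hMi0 a haI).const_mul C1)).const_mul _)
      intro r hr
      exact (hqle r ⟨hr.1, hr.2.trans_le ha1⟩).2
    have j1 : ∫ r in a..1, g r / (r * μ r) ≤ ∫ r in a..1, κ * (1 / r + C1 * M r) := by
      apply intervalIntegral.integral_mono_on_of_le_Ioo ha1 hi1
        ((hinv.add ((hMi1 a haI).const_mul C1)).const_mul _)
      intro r hr
      exact (hqle r ⟨ha0.trans hr.1, hr.2⟩).1
    rw [intervalIntegral.integral_const_mul, intervalIntegral.integral_add hlin ((hMi0 a haI).const_mul C1),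
      intervalIntegral.integral_const_mul] at j0
    rw [intervalIntegral.integral_const_mul, intervalIntegral.integral_add hinv ((hMi1 a haI).const_mul C1),
      intervalIntegral.integral_const_mul, integral_one_div_of_pos ha0 one_pos] at j1
    have l0 : ∫ r in (0:ℝ)..a, α * r / 2 = 1 / 4 := by
      have : (fun r : ℝ => α * r / 2) = fun r => (α / 2) * r := by ext r; ring
      rw [this, intervalIntegral.integral_const_mul, integral_id, ha, div_pow, Real.sq_sqrt hα0.le]
      field_simp; norm_num
    have l1 : Real.log (1 / a) = Real.log α / 2 := by
      rw [ha, one_div_one_div, Real.log_sqrt hα0.le]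
    have l2 : m = (∫ r in (0:ℝ)..a, M r) + ∫ r in a..1, M r := by
      rw [hm, intervalIntegral.integral_add_adjacent_intervals (hMi0 a haI) (hMi1 a haI)]
    rw [l0] at j0
    rw [l1] at j1
    rw [l2]
    calc _ ≤ _ := add_le_add j0 j1
      _ = _ := by ring

lemma M_mono (D : GelfandData) : MonotoneOn D.M (Ico 0 1) := by
  intro s hs t ht hst
  obtain ⟨⟨y, hy, hye⟩, -⟩ := D.M_def s hs
  rw [← hye]
  exact (D.M_def t ht).2 ⟨y, ⟨hy.1, hy.2.trans hst⟩, rfl⟩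

lemma M_ge (D : GelfandData) {s : ℝ} (hs : s ∈ Ico (0:ℝ) 1) : D.psi s / D.phi s ≤ D.M s :=
  (D.M_def s hs).2 ⟨s, ⟨hs.1, le_refl _⟩, rfl⟩

lemma M_one (D : GelfandData) {s : ℝ} (hs : s ∈ Ico (0:ℝ) 1) : 1 ≤ D.M s := by
  have := (D.M_def s hs).2 ⟨0, ⟨le_refl _, hs.1⟩, rfl⟩
  simpa [D.phi_zero, D.psi_zero] using this

lemma phi_cont (D : GelfandData) : ContinuousOn D.phi (Icc 0 1) := by
  obtain ⟨L, hL⟩ := D.phi_lip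
  exact hL.continuousOn

lemma psi_cont (D : GelfandData) : ContinuousOn D.psi (Icc 0 1) := by
  obtain ⟨L, hL⟩ := D.psi_lip
  exact hL.continuousOn

lemma M_cont (D : GelfandData) : ContinuousOn D.M (Ico 0 1) := by
  have hc : ContinuousOn (fun r => D.psi r / D.phi r) (Ico 0 1) :=
    ((psi_cont D).mono Ico_subset_Icc_self).div ((phi_cont D).mono Ico_subset_Icc_self)
      (fun r hr => (D.phi_pos r hr).ne')
  rw [Metric.continuousOn_iff]
  intro s hs ε hε
  obtain ⟨δ, hδ, h⟩ := Metric.continuousOn_iff.1 hc s hs (ε/3) (by positivity)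
  refine ⟨δ, hδ, fun t ht hts => ?_⟩
  have hks : ∀ x ∈ Ico (0:ℝ) 1, |x - s| < δ →
      |D.psi x / D.phi x - D.psi s / D.phi s| < ε / 3 := fun x hx hxs => h x hx hxs
  rw [Real.dist_eq] at hts ⊢
  rcases le_total s t with hst | hst
  · rw [abs_of_nonneg (sub_nonneg.2 (M_mono D hs ht hst))]
    obtain ⟨⟨y, hy, hye⟩, -⟩ := D.M_def t ht
    simp only at hye
    rw [← hye]
    rcases le_total y s with hys | hys
    · have := (D.M_def s hs).2 ⟨y, ⟨hy.1, hys⟩, rfl⟩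
      simp only at this
      linarith
    · have h1 := hks y ⟨hy.1, hy.2.trans_lt ht.2⟩ (by
        rw [abs_of_nonneg (sub_nonneg.2 hst)] at hts
        rw [abs_of_nonneg (sub_nonneg.2 hys)]; linarith [hy.2])
      have := M_ge D hs
      linarith [(abs_lt.1 h1).2]
  · rw [abs_sub_comm, abs_of_nonneg (sub_nonneg.2 (M_mono D ht hs hst))]
    obtain ⟨⟨y, hy, hye⟩, -⟩ := D.M_def s hs
    simp only at hye
    rw [← hye]
    have h2 := hks t ht hts
    rw [abs_sub_comm, abs_of_nonneg (sub_nonneg.2 hst)] at hts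
    rcases le_total y t with hys | hys
    · have := (D.M_def t ht).2 ⟨y, ⟨hy.1, hys⟩, rfl⟩
      simp only at this
      linarith
    · have h1 := hks y ⟨hy.1, hy.2.trans_lt hs.2⟩ (by
        rw [abs_sub_comm, abs_of_nonneg (sub_nonneg.2 hy.2)]; linarith)
      have := M_ge D ht
      linarith [(abs_lt.1 h1).2, (abs_lt.1 h2).1]

lemma phi_half (D : GelfandData) : 0 < D.phi (1/2) := D.phi_pos _ (by constructor <;> norm_num)

lemma M_div_le (D : GelfandData) : ∃ C1 : ℝ, 0 ≤ C1 ∧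
    ∀ r ∈ Ioo (0:ℝ) 1, D.M r / r ≤ 1 / r + C1 * D.M r := by
  obtain ⟨L, hL⟩ := D.phi_lip
  have hp := phi_half D
  refine ⟨L / D.phi (1/2) + 2, by positivity, fun r hr => ?_⟩
  have hr0 := hr.1
  have hrI : r ∈ Ico (0:ℝ) 1 := ⟨hr.1.le, hr.2⟩
  have hM := M_one D hrI
  have hLp : 0 ≤ (L:ℝ) / D.phi (1/2) := by positivity
  rcases le_total (1/2) r with h | h
  · have : D.M r / r ≤ 2 * D.M r := by
      rw [div_le_iff₀ hr0]; nlinarith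
    have : 0 < 1 / r := by positivity
    nlinarith
  · obtain ⟨⟨y, hy, hye⟩, -⟩ := D.M_def r hrI
    simp only at hye
    have hyI : y ∈ Icc (0:ℝ) 1 := ⟨hy.1, hy.2.trans hr.2.le⟩
    have hφ : D.phi (1/2) ≤ D.phi y := D.phi_anti hyI (by constructor <;> norm_num) (hy.2.trans h)
    have hψ : D.psi y ≤ 1 := by
      rw [← D.psi_zero]; exact D.psi_anti (by simp) hyI hy.1
    have hl : 1 - D.phi y ≤ L * y := by
      have := hL.dist_le_mul 0 (by simp) y hyI
      rw [D.phi_zero, Real.dist_eq, Real.dist_eq, zero_sub, abs_neg, abs_of_nonneg hy.1] at this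
      exact (le_abs_self _).trans this
    have h1 : D.M r ≤ 1 + L / D.phi (1/2) * r := by
      rw [← hye, div_le_iff₀ (hp.trans_le hφ)]
      have h2 : (L:ℝ) * y ≤ L / D.phi (1/2) * r * D.phi y := by
        have h3 : (L:ℝ) / D.phi (1/2) * r * D.phi y = L * r * (D.phi y / D.phi (1/2)) := by field_simp
        rw [h3]
        have h4 : 1 ≤ D.phi y / D.phi (1/2) := by rw [le_div_iff₀ hp]; linarith
        have h5 : (L:ℝ) * y ≤ L * r := mul_le_mul_of_nonneg_left hy.2 L.2
        have h6 : 0 ≤ (L:ℝ) * r := mul_nonneg L.2 hr0.le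
        nlinarith
      linarith
    have h2 : D.M r / r ≤ 1 / r + L / D.phi (1/2) := by
      have : 1 / r + L / D.phi (1/2) = (1 + L / D.phi (1/2) * r) / r := by field_simp
      rw [this]; gcongr
    nlinarith

lemma arith_bound {x l G C2 k c : ℝ} (hx : 0 < x) (hl : 1 ≤ l) (hC : 0 ≤ C2) (hk : 0 ≤ k) (hG : 0 ≤ G)
    (hc : 2 * G * (C2 + k * G + 2 * k * C2 * G) ≤ c)
    (h : x ≤ 2 / l * (G - c / l)) : x * (1 + k * x) * (l / 2 + C2) ≤ G := by
  have hl0 : 0 < l := by linarith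
  have h1 : x * l / 2 ≤ G - c / l := by
    have := mul_le_mul_of_nonneg_right h hl0.le
    have e : 2 / l * (G - c / l) * l = 2 * (G - c / l) := by field_simp
    linarith
  have hc0 : 0 ≤ c := le_trans (by positivity) hc
  have h2 : 0 ≤ c / l := by positivity
  have h3 : x * l ≤ 2 * G := by linarith
  have h4 : x ≤ 2 * G := by nlinarith
  have h5 : x ≤ 2 * G / l := by rw [le_div_iff₀ hl0]; exact h3
  have h6 : x * (C2 + k * G + 2 * k * C2 * G) ≤ c / l := by
    calc _ ≤ 2 * G / l * (C2 + k * G + 2 * k * C2 * G) := mul_le_mul_of_nonneg_right h5 (by positivity)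
      _ = 2 * G * (C2 + k * G + 2 * k * C2 * G) / l := by ring
      _ ≤ c / l := by gcongr
  have h7 : k * x * (x * l) ≤ k * x * (2 * G) := mul_le_mul_of_nonneg_left h3 (by positivity)
  have h8 : k * x * C2 * x ≤ k * x * C2 * (2 * G) := mul_le_mul_of_nonneg_left h4 (by positivity)
  nlinarith

lemma small_bound {x l G k : ℝ} (hx : 0 < x) (hG : 0 < G) (hxl : x * l ≤ 2 * G)
    (hl : 1 + 2 * G * k ≤ l) : k * x ≤ 1 := by
  by_contra hcon
  push Not at hcon
  have h2 : x * (1 + 2 * G * k) ≤ 2 * G := (mul_le_mul_of_nonneg_left hl hx.le).trans hxl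
  have h3 := mul_lt_mul_of_pos_left hcon hG
  nlinarith

set_option maxHeartbeats 1000000

/-- For every `w > 0` there are `c > 0` and `α₀` such that for all
`α ≥ α₀` and every `λ` with
`0 < λ ≤ (2Kα/log α)(1 - ε_w/K - c (f'(w) + 1)/log α)` (with `ε_w = ∫_w^∞ ds/f(s)`),
problem `(P_{α,λ})` admits a solution `u` with `∫_{u(0)}^∞ ds/f(s) ≥ ε_w`. -/
theorem solvable_lower_range (D : GelfandData) (w : ℝ) (hw : 0 < w) :
    ∃ c > (0:ℝ), ∃ α₀ : ℝ, ∀ α ≥ α₀, ∀ lam : ℝ, 0 < lam →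
      lam ≤ 2 * D.K * α / Real.log α *
        (1 - (∫ s in Ioi w, 1 / D.f s) / D.K
          - c * (derivWithin D.f (Ici 0) w + 1) / Real.log α) →
      ∃ u, IsSolution D α lam u ∧
        (∫ s in Ioi w, 1 / D.f s) ≤ ∫ s in Ioi (u 0), 1 / D.f s := by
  have hphalf := phi_half D
  obtain ⟨C1, hC1, hMC⟩ := M_div_le D
  -- truncated nonlinearity
  let F : ℝ → ℝ := fun s => D.f (max 0 (min s w))
  have hcl : ∀ s, max 0 (min s w) ∈ Icc 0 w := fun s =>
    ⟨le_max_left _ _, max_le hw.le (min_le_right _ _)⟩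
  have hF : Continuous F := D.f_smooth.continuousOn.comp_continuous (by fun_prop) (fun s => (hcl s).1)
  have hF0 : ∀ s, 0 < F s := fun s => D.f_pos _ (hcl s).1
  have hFA : ∀ s, F s ≤ D.f w := fun s => D.f_mono (hcl s).1 hw.le (hcl s).2
  have hFm : Monotone F := fun s t hst => D.f_mono (hcl s).1 (hcl t).1
    (max_le_max le_rfl (min_le_min hst le_rfl))
  have hFe : ∀ s ∈ Icc 0 w, F s = D.f s := fun s hs => by
    simp only [F]; rw [min_eq_left hs.2, max_eq_right hs.1]
  have hFd : ∀ x ∈ Ioo 0 w, HasDerivAt F (derivWithin D.f (Ici 0) x) x := by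
    intro x hx
    have h1 : HasDerivAt D.f (derivWithin D.f (Ici 0) x) x :=
      ((D.f_smooth.differentiableOn (by norm_num)) x hx.1.le).hasDerivWithinAt.hasDerivAt (Ici_mem_nhds hx.1)
    refine h1.congr_of_eventuallyEq ?_
    filter_upwards [Ioo_mem_nhds hx.1 hx.2] with y hy
    exact hFe y ⟨hy.1.le, hy.2.le⟩
  have hdc : ContinuousOn (derivWithin D.f (Ici 0)) (Ici 0) :=
    D.f_smooth.continuousOn_derivWithin (uniqueDiffOn_Ici 0) le_rfl
  obtain ⟨B0, hB0⟩ := (isCompact_Icc (a := (0:ℝ)) (b := w)).exists_bound_of_continuousOn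
    (hdc.mono Icc_subset_Ici_self)
  have hB0' : 0 ≤ B0 := (norm_nonneg _).trans (hB0 0 ⟨le_rfl, hw.le⟩)
  set B := B0 + 1 with hB
  have hBpos : 0 < B := by linarith
  have hFB : ∀ x ∈ Ioo 0 w, derivWithin D.f (Ici 0) x ≤ B := fun x hx => by
    have := (le_abs_self _).trans (hB0 x ⟨hx.1.le, hx.2.le⟩)
    linarith
  have hf'w : 0 ≤ derivWithin D.f (Ici 0) w := D.f_mono.derivWithin_nonneg
  -- the total mass
  set G := ∫ s in (0:ℝ)..w, 1 / F s with hG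
  have hFi : Continuous (fun s => 1 / F s) := continuous_const.div hF (fun x => (hF0 x).ne')
  have hGpos : 0 < G := intervalIntegral.intervalIntegral_pos_of_pos_on (hFi.intervalIntegrable _ _)
    (fun x _ => div_pos one_pos (hF0 x)) hw
  set εw := ∫ s in Ioi w, 1 / D.f s with hεw
  have hε0 : 0 ≤ εw := setIntegral_nonneg measurableSet_Ioi
    (fun s hs => (div_pos one_pos (D.f_pos s (hw.le.trans (le_of_lt hs)))).le)
  have hKG : D.K = G + εw := by
    have h1 : G = ∫ s in (0:ℝ)..w, 1 / D.f s := by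
      apply intervalIntegral.integral_congr
      intro s hs
      rw [uIcc_of_le hw.le] at hs
      simp only [hFe s hs]
    rw [D.K_def, h1, hεw, intervalIntegral.integral_of_le hw.le, ← Ioc_union_Ioi_eq_Ioi hw.le,
      setIntegral_union (Ioc_disjoint_Ioi le_rfl) measurableSet_Ioi
        (D.f_int.mono_set Ioc_subset_Ioi_self) (D.f_int.mono_set (Ioi_subset_Ioi hw.le))]
  have hK : 0 < D.K := by linarith
  -- the weight
  let phi' : ℝ → ℝ := fun r => D.phi (clampU r)
  let psi' : ℝ → ℝ := fun r => D.psi (clampU r)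
  have hphi : Continuous phi' := (phi_cont D).comp_continuous clampU_cont clampU_mem
  have hpsi : Continuous psi' := (psi_cont D).comp_continuous clampU_cont clampU_mem
  have hphie : ∀ r ∈ Icc (0:ℝ) 1, phi' r = D.phi r := fun r hr => by simp only [phi']; rw [clampU_eq hr]
  have hpsie : ∀ r ∈ Icc (0:ℝ) 1, psi' r = D.psi r := fun r hr => by simp only [psi']; rw [clampU_eq hr]
  have hphi0 : ∀ r, 0 ≤ phi' r := fun r => D.phi_nonneg _ (clampU_mem r)
  have hpsi0 : ∀ r, 0 ≤ psi' r := fun r => D.psi_nonneg _ (clampU_mem r)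
  have hphi1 : ∀ r, phi' r ≤ 1 := fun r => by
    rw [← D.phi_zero]; exact D.phi_anti (by simp) (clampU_mem r) (clampU_mem r).1
  have hpsi1 : ∀ r, psi' r ≤ 1 := fun r => by
    rw [← D.psi_zero]; exact D.psi_anti (by simp) (clampU_mem r) (clampU_mem r).1
  have hphip : ∀ r ∈ Ico (0:ℝ) 1, 0 < phi' r := fun r hr => by
    rw [hphie r ⟨hr.1, hr.2.le⟩]; exact D.phi_pos r hr
  have hψ : ∀ r ∈ Ioo (0:ℝ) 1, psi' r ≤ D.M r * phi' r := fun r hr => by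
    have hr' : r ∈ Icc (0:ℝ) 1 := ⟨hr.1.le, hr.2.le⟩
    rw [hphie r hr', hpsie r hr', ← div_le_iff₀ (D.phi_pos r ⟨hr.1.le, hr.2⟩)]
    exact M_ge D ⟨hr.1.le, hr.2⟩
  have hhI : (1/2:ℝ) ∈ Icc (0:ℝ) 1 := by constructor <;> norm_num
  have hp : ∀ r ∈ Icc (0:ℝ) (1/2), D.phi (1/2) ≤ phi' r := fun r hr => by
    have hr' : r ∈ Icc (0:ℝ) 1 := ⟨hr.1, hr.2.trans hhI.2⟩
    rw [hphie r hr']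
    exact D.phi_anti hr' hhI hr.2
  have hMM : ∀ r ∈ Icc (0:ℝ) (1/2), D.M r ≤ D.M (1/2) := fun r hr =>
    M_mono D ⟨hr.1, hr.2.trans_lt (by norm_num)⟩ (by constructor <;> norm_num) hr.2
  have hMi : IntervalIntegrable D.M volume 0 1 := by
    rw [intervalIntegrable_iff_integrableOn_Ioo_of_le (zero_le_one' ℝ)]; exact D.M_int
  have hM1 : 1 ≤ D.M (1/2) := M_one D (by constructor <;> norm_num)
  set m := ∫ r in (0:ℝ)..1, D.M r with hm
  have hm0 : 0 ≤ m := by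
    have : ∫ r in (0:ℝ)..1, (0:ℝ) ≤ m := by
      apply intervalIntegral.integral_mono_on_of_le_Ioo zero_le_one (by simp) hMi
      intro s hs
      linarith [M_one D ⟨hs.1.le, hs.2⟩]
    simpa using this
  -- constants
  set k := 8 * B * D.M (1/2) / D.phi (1/2) with hk
  have hk0 : 0 ≤ k := by positivity
  set n := 16 * B * m with hn
  have hn0 : 0 ≤ n := by positivity
  set C2 := 1 / 4 + C1 * m with hC2
  have hC20 : 0 ≤ C2 := by positivity
  set c' := 2 * G * (C2 + (k + 2 * n) * G + 2 * (k + 2 * n) * C2 * G) with hc'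
  have hc'0 : 0 ≤ c' := by positivity
  refine ⟨(c' + 1) / D.K, by positivity, Real.exp (1 + 2 * G * k + 2 * G * n), fun α hα lam hlam hle => ?_⟩
  set l := Real.log α with hl
  have hα0 : 0 < α := (Real.exp_pos _).trans_le hα
  have hll : 1 + 2 * G * k + 2 * G * n ≤ l := (Real.le_log_iff_exp_le hα0).2 hα
  have hGk : 0 ≤ 2 * G * k := by positivity
  have hGn : 0 ≤ 2 * G * n := by positivity
  have hl1 : 1 ≤ l := by linarith
  have hl0 : 0 < l := by linarith
  have hα1 : 1 ≤ α := (Real.one_le_exp (by linarith)).trans hα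
  set x := lam / α with hx
  have hx0 : 0 < x := div_pos hlam hα0
  have hxle : x ≤ 2 / l * (G - (c' + 1) / l) := by
    rw [hx, div_le_iff₀ hα0]
    refine hle.trans ?_
    have e1 : 2 * D.K * α / l * (1 - εw / D.K - (c' + 1) / D.K * (derivWithin D.f (Ici 0) w + 1) / l)
        = 2 / l * ((D.K - εw) - (c' + 1) * (derivWithin D.f (Ici 0) w + 1) / l) * α := by
      field_simp
    rw [e1, hKG]
    have : (c' + 1) / l ≤ (c' + 1) * (derivWithin D.f (Ici 0) w + 1) / l := by
      gcongr
      nlinarith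
    gcongr
    linarith
  have hxl : x * l ≤ 2 * G := by
    have h1 := mul_le_mul_of_nonneg_right hxle hl0.le
    have e : 2 / l * (G - (c' + 1) / l) * l = 2 * (G - (c' + 1) / l) := by field_simp
    have : 0 ≤ (c' + 1) / l := by positivity
    linarith
  have hkx : k * x ≤ 1 := small_bound hx0 hGpos hxl (by linarith)
  have hnx : n * x ≤ 1 := small_bound hx0 hGpos hxl (by linarith)
  let μ : ℝ → ℝ := fun r => Real.exp (α * ∫ s in (0:ℝ)..r, s * phi' s)
  have hμdef : ∀ r, μ r = Real.exp (α * ∫ s in (0:ℝ)..r, s * phi' s) := fun r => rfl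
  have hμd := mu_hasDeriv hphi hμdef
  have hμ : Continuous μ := continuous_iff_continuousAt.2 fun r => (hμd r).continuousAt
  have hμ0 : ∀ r, 0 < μ r := fun r => Real.exp_pos _
  have hμm : MonotoneOn μ (Icc 0 1) := by
    apply monotoneOn_of_deriv_nonneg (convex_Icc 0 1) hμ.continuousOn
    · exact fun r _ => (hμd r).differentiableAt.differentiableWithinAt
    · intro r hr
      rw [interior_Icc] at hr
      rw [(hμd r).deriv]
      exact mul_nonneg (hμ0 r).le (mul_nonneg hα0.le (mul_nonneg hr.1.le (hphi0 r)))
  obtain ⟨g, g', hgc, hg0, hgpos, hgd, hgi, hgint, hgle⟩ := exists_g (θ := 8 * (B * (lam / α)) * D.M (1/2) / D.phi (1/2))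
    (m := m) (psi' := psi') hα1 hlam hBpos hphi hphi0 hphi1 hphip
    hμdef (M_cont D) (M_mono D) (fun r hr => M_one D hr) hMi hψ hphalf hp hMM hMC hC1 hm rfl
    (by refine le_trans (le_of_eq ?_) hkx
        rw [hk, ← hx]; ring)
    (by rw [← hx]; linarith [show 8 * (B * x) * m = n * x / 2 by rw [hn]; ring])
  have hGle : ∫ r in (0:ℝ)..1, g r / (r * μ r) ≤ G := by
    refine hgle.trans (le_trans ?_ (arith_bound (c := c' + 1) hx0 hl1 hC20 (show 0 ≤ k + 2 * n by positivity)
      hGpos.le (by rw [hc']; linarith) hxle))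
    have e1 : 8 * (B * x) * D.M (1/2) / D.phi (1/2) = k * x := by rw [hk]; ring
    have e2 : 16 * (B * x) * m = n * x := by rw [hn]; ring
    rw [← hx, e1, e2]
    have e3 : (1 + k * x) * (1 + n * x) ≤ 1 + (k + 2 * n) * x := by
      have : k * x * (n * x) ≤ 1 * (n * x) := mul_le_mul_of_nonneg_right hkx (by positivity)
      nlinarith
    have e4 : l / 2 + 1 / 4 + C1 * m = l / 2 + C2 := by rw [hC2]; ring
    rw [e4]
    exact mul_le_mul_of_nonneg_right (mul_le_mul_of_nonneg_left e3 hx0.le) (by positivity)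
  obtain ⟨U, hUc, hU0, hUw, hTU⟩ := super_of_g (lam := lam) (B := B) (w := w) hpsi hμ hμ0 hF hF0 hFA hFd hFB
    hgc hg0 hgpos hgd hgi hgint hGle
  obtain ⟨u, huc, hu0, huU, hfix⟩ := exists_fixed (ψ := fun s => lam * psi' s) (Q := lam) hμ hμ0 hμm
    (by fun_prop) (fun s => mul_nonneg hlam.le (hpsi0 s)) (fun s => by nlinarith [hpsi1 s])
    hF (fun s => (hF0 s).le) hFA hFm hUc hU0 hTU
  have huw : ∀ s, u s ∈ Icc 0 w := fun s => ⟨hu0 s, (huU s).trans (hUw s)⟩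
  obtain ⟨v, hv, hv0⟩ := isSolution_of_fixed D (α := α) hlam hphi hpsi hF hphie hpsie hpsi0 hF0 hμdef huc
    (fun r _ => hFe _ (huw r)) hfix
  refine ⟨v, hv, ?_⟩
  rw [hv0]
  have hu00 := huw 0
  apply setIntegral_mono_set (D.f_int.mono_set (Ioi_subset_Ioi hu00.1))
  · refine (ae_restrict_iff' measurableSet_Ioi).2 (Eventually.of_forall fun s hs => ?_)
    exact (div_pos one_pos (D.f_pos s (hu00.1.trans (le_of_lt hs)))).le
  · exact (Ioi_subset_Ioi hu00.2).eventuallyLE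
end

section
/- For every ϑ ∈ (0,1] and every δ ∈ (0,1/4) there exist a constant c > 0 (depending only on ϑ, δ, f, φ, ψ) and α₀ such that for all α ≥ α₀: every solution u of problem (P_{α,λ}) with ϑ λ*(α) < λ ≤ λ*(α) satisfies u(r) ≤ c (1 + log(1/r)) / log α for all r ∈ [α^{−(1/2 − 2δ)}, 1]. -/
open Set MeasureTheory Filter

namespace GJ

lemma le_of_hasDeriv {a b : ℝ} {g g' : ℝ → ℝ} (hab : a ≤ b) (hc : ContinuousOn g (Icc a b))
    (hd : ∀ x ∈ Ioo a b, HasDerivAt g (g' x) x) (hn : ∀ x ∈ Ioo a b, 0 ≤ g' x) : g a ≤ g b := by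
  have : MonotoneOn g (Icc a b) := by
    apply monotoneOn_of_deriv_nonneg (convex_Icc a b) hc
    · intro x hx
      rw [interior_Icc] at hx
      exact (hd x hx).differentiableAt.differentiableWithinAt
    · intro x hx
      rw [interior_Icc] at hx
      rw [(hd x hx).deriv]
      exact hn x hx
  exact this (left_mem_Icc.2 hab) (right_mem_Icc.2 hab) hab

/-- clamp to `[0,1]` -/
noncomputable def cl (t : ℝ) : ℝ := max 0 (min 1 t)

lemma cl_mem (t : ℝ) : cl t ∈ Icc (0:ℝ) 1 := by
  unfold cl; constructor
  · exact le_max_left _ _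
  · exact max_le zero_le_one (min_le_left _ _)

lemma cl_eq {t : ℝ} (h : t ∈ Icc (0:ℝ) 1) : cl t = t := by
  unfold cl; rw [min_eq_right h.2, max_eq_right h.1]

lemma cl_cont : Continuous cl := by unfold cl; fun_prop

lemma cl_lip (x y : ℝ) : |cl x - cl y| ≤ |x - y| := by
  unfold cl
  have h1 := abs_max_sub_max_le_abs (min 1 x) (min 1 y) 0
  have h2 := abs_min_sub_min_le_max 1 x 1 y
  rw [max_comm 0, max_comm 0]
  refine h1.trans (h2.trans ?_)
  simp

noncomputable def phe (D : GelfandData) (t : ℝ) : ℝ := D.phi (cl t)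
noncomputable def pse (D : GelfandData) (t : ℝ) : ℝ := D.psi (cl t)
noncomputable def fe (D : GelfandData) (t : ℝ) : ℝ := D.f (cl t)

lemma phe_cont (D : GelfandData) : Continuous (phe D) := by
  obtain ⟨L, hL⟩ := D.phi_lip
  exact hL.continuousOn.comp_continuous cl_cont cl_mem

lemma pse_cont (D : GelfandData) : Continuous (pse D) := by
  obtain ⟨L, hL⟩ := D.psi_lip
  exact hL.continuousOn.comp_continuous cl_cont cl_mem

lemma fe_cont (D : GelfandData) : Continuous (fe D) :=
  D.f_smooth.continuousOn.comp_continuous cl_cont (fun x => (cl_mem x).1)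

lemma phe_eq (D : GelfandData) {t : ℝ} (h : t ∈ Icc (0:ℝ) 1) : phe D t = D.phi t := by
  unfold phe; rw [cl_eq h]
lemma pse_eq (D : GelfandData) {t : ℝ} (h : t ∈ Icc (0:ℝ) 1) : pse D t = D.psi t := by
  unfold pse; rw [cl_eq h]
lemma phe_nonneg (D : GelfandData) (t : ℝ) : 0 ≤ phe D t := D.phi_nonneg _ (cl_mem t)
lemma pse_nonneg (D : GelfandData) (t : ℝ) : 0 ≤ pse D t := D.psi_nonneg _ (cl_mem t)
lemma phe_le (D : GelfandData) (t : ℝ) : phe D t ≤ 1 := by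
  rw [← D.phi_zero]
  exact D.phi_anti (by simp) (cl_mem t) (cl_mem t).1
lemma pse_le (D : GelfandData) (t : ℝ) : pse D t ≤ 1 := by
  rw [← D.psi_zero]
  exact D.psi_anti (by simp) (cl_mem t) (cl_mem t).1

lemma fe_lip (D : GelfandData) : ∃ L : ℝ, 0 < L ∧ ∀ x y, |fe D x - fe D y| ≤ L * |x - y| := by
  have h : ContDiffOn ℝ 1 D.f (Icc 0 1) := D.f_smooth.mono Icc_subset_Ici_self
  obtain ⟨K, hK⟩ := h.exists_lipschitzOnWith one_ne_zero (convex_Icc 0 1) isCompact_Icc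
  refine ⟨K + 1, by positivity, fun x y => ?_⟩
  have := hK.dist_le_mul _ (cl_mem x) _ (cl_mem y)
  rw [Real.dist_eq, Real.dist_eq] at this
  have h2 := cl_lip x y
  have h3 : (K:ℝ) * |cl x - cl y| ≤ K * |x - y| := by gcongr
  unfold fe
  nlinarith [abs_nonneg (x - y)]

lemma fe_pos (D : GelfandData) (x : ℝ) : 0 < fe D x := D.f_pos _ (cl_mem x).1
lemma fe_le (D : GelfandData) (x : ℝ) : fe D x ≤ D.f 1 :=
  D.f_mono (cl_mem x).1 (by simp) (cl_mem x).2

lemma M_ge (D : GelfandData) {s t : ℝ} (hs : s ∈ Ico (0:ℝ) 1) (ht : t ∈ Icc 0 s) :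
    pse D t ≤ D.M s * phe D t := by
  have ht1 : t ∈ Icc (0:ℝ) 1 := ⟨ht.1, ht.2.trans hs.2.le⟩
  have h := (D.M_def s hs).2 ⟨t, ht, rfl⟩
  have hp := D.phi_pos t ⟨ht.1, ht.2.trans_lt hs.2⟩
  rw [pse_eq D ht1, phe_eq D ht1]
  rwa [div_le_iff₀ hp] at h

lemma M_one (D : GelfandData) {s : ℝ} (hs : s ∈ Ico (0:ℝ) 1) : 1 ≤ D.M s := by
  have h := M_ge D hs (t := 0) ⟨le_rfl, hs.1⟩
  rw [pse_eq D (by simp), phe_eq D (by simp), D.phi_zero, D.psi_zero] at h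
  linarith

lemma M_mono (D : GelfandData) {s t : ℝ} (hs : s ∈ Ico (0:ℝ) 1) (ht : t ∈ Icc 0 s) :
    D.M t ≤ D.M s := by
  have ht1 : t ∈ Ico (0:ℝ) 1 := ⟨ht.1, ht.2.trans_lt hs.2⟩
  obtain ⟨r, hr, h⟩ := (D.M_def t ht1).1
  rw [← h]
  exact (D.M_def s hs).2 ⟨r, ⟨hr.1, hr.2.trans ht.2⟩, rfl⟩

lemma M_ii (D : GelfandData) {a b : ℝ} (ha : 0 ≤ a) (hab : a ≤ b) (hb : b ≤ 1) :
    IntervalIntegrable D.M volume a b := by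
  rw [intervalIntegrable_iff_integrableOn_Ioo_of_le hab]
  exact D.M_int.mono_set (Ioo_subset_Ioo ha hb)

lemma M_integral_le (D : GelfandData) {a : ℝ} (ha : 0 ≤ a) (hab : a ≤ 1) :
    ∫ s in a..1, D.M s ≤ ∫ s in (0:ℝ)..1, D.M s := by
  have := intervalIntegral.integral_add_adjacent_intervals (M_ii D le_rfl ha hab) (M_ii D ha hab le_rfl)
  have h : 0 ≤ ∫ s in (0:ℝ)..a, D.M s := by
    have := intervalIntegral.integral_mono_on_of_le_Ioo ha (f := fun _ => (0:ℝ))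
      (g := D.M) (by simp) (M_ii D le_rfl ha hab) (fun x hx => by
        have := M_one D (s := x) ⟨hx.1.le, hx.2.trans_le hab⟩
        linarith)
    simpa using this
  linarith

/-- the weight -/
noncomputable def mw (D : GelfandData) (α r : ℝ) : ℝ :=
  Real.exp (α * ∫ s in (0:ℝ)..r, s * phe D s)

lemma mw_pos (D : GelfandData) (α r : ℝ) : 0 < mw D α r := Real.exp_pos _
lemma mw_zero (D : GelfandData) (α : ℝ) : mw D α 0 = 1 := by simp [mw]

lemma mw_deriv (D : GelfandData) (α r : ℝ) :
    HasDerivAt (mw D α) (α * (r * phe D r) * mw D α r) r := by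
  have hc : Continuous (fun s => s * phe D s) := continuous_id.mul (phe_cont D)
  have h := ((hc.integral_hasStrictDerivAt 0 r).hasDerivAt.const_mul α).exp
  unfold mw
  convert h using 1
  ring

lemma mw_cont (D : GelfandData) (α : ℝ) : Continuous (mw D α) :=
  continuous_iff_continuousAt.2 (fun r => (mw_deriv D α r).continuousAt)

lemma mw_mono (D : GelfandData) {α : ℝ} (hα : 0 ≤ α) {a b : ℝ} (ha : 0 ≤ a) (hab : a ≤ b) :
    mw D α a ≤ mw D α b := by
  apply le_of_hasDeriv hab (mw_cont D α).continuousOn (fun x _ => mw_deriv D α x)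
  intro x hx
  have := phe_nonneg D x
  have := mw_pos D α x
  have : 0 ≤ x := ha.trans hx.1.le
  positivity

lemma mw_lower (D : GelfandData) {α : ℝ} (hα : 0 ≤ α) {a b : ℝ} (ha : 0 ≤ a) (hab : a ≤ b)
    (hb : b ≤ 1/2) :
    mw D α a * Real.exp (α * (D.phi (1/2) / 2 * (b^2 - a^2))) ≤ mw D α b := by
  have hc : Continuous (fun s => s * phe D s) := continuous_id.mul (phe_cont D)
  have key := le_of_hasDeriv (g := fun r => (∫ s in (0:ℝ)..r, s * phe D s) - D.phi (1/2) / 2 * r^2)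
    (g' := fun r => r * phe D r - D.phi (1/2) / 2 * (2 * r)) hab
    (by
      apply ContinuousOn.sub
      · exact (continuous_iff_continuousAt.2 (fun r =>
          (hc.integral_hasStrictDerivAt 0 r).hasDerivAt.continuousAt)).continuousOn
      · fun_prop)
    (fun r _ => by
      have h1 := (hc.integral_hasStrictDerivAt 0 r).hasDerivAt
      have h2 := ((hasDerivAt_id r).pow 2).const_mul (D.phi (1/2) / 2)
      refine (h1.sub h2).congr_deriv ?_
      simp)
    (fun r hr => by
      have hr0 : 0 ≤ r := ha.trans hr.1.le
      have hr1 : r ∈ Icc (0:ℝ) 1 := ⟨hr0, by linarith [hr.2]⟩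
      have : D.phi (1/2) ≤ phe D r := by
        rw [phe_eq D hr1]
        exact D.phi_anti hr1 (by norm_num) (by linarith [hr.2])
      nlinarith)
  unfold mw
  rw [← Real.exp_add]
  apply Real.exp_le_exp.2
  nlinarith

noncomputable def Hf (D : GelfandData) (α : ℝ) (g : ℝ → ℝ) (s : ℝ) : ℝ :=
  ∫ t in (0:ℝ)..s, g t * (t * mw D α t)

noncomputable def qf (D : GelfandData) (α : ℝ) (g : ℝ → ℝ) (s : ℝ) : ℝ :=
  dslope (Hf D α g) 0 s / mw D α s

lemma Hint_cont (D : GelfandData) (α : ℝ) {g : ℝ → ℝ} (hg : Continuous g) :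
    Continuous (fun t => g t * (t * mw D α t)) :=
  hg.mul (continuous_id.mul (mw_cont D α))

lemma Hf_deriv (D : GelfandData) (α : ℝ) {g : ℝ → ℝ} (hg : Continuous g) (s : ℝ) :
    HasDerivAt (Hf D α g) (g s * (s * mw D α s)) s :=
  ((Hint_cont D α hg).integral_hasStrictDerivAt 0 s).hasDerivAt

lemma qf_eq (D : GelfandData) (α : ℝ) (g : ℝ → ℝ) {s : ℝ} (hs : s ≠ 0) :
    qf D α g s = Hf D α g s / (s * mw D α s) := by
  unfold qf
  rw [dslope_of_ne _ hs, slope_def_field]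
  simp [Hf, div_div]

lemma qf_zero (D : GelfandData) (α : ℝ) {g : ℝ → ℝ} (hg : Continuous g) : qf D α g 0 = 0 := by
  unfold qf
  rw [dslope_same, (Hf_deriv D α hg 0).deriv]
  simp

lemma qf_cont (D : GelfandData) (α : ℝ) {g : ℝ → ℝ} (hg : Continuous g) :
    Continuous (qf D α g) := by
  have h1 : Continuous (dslope (Hf D α g) 0) := by
    rw [← continuousOn_univ, continuousOn_dslope univ_mem]
    refine ⟨fun s _ => (Hf_deriv D α hg s).continuousAt.continuousWithinAt,
      (Hf_deriv D α hg 0).differentiableAt⟩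
  exact h1.div (mw_cont D α) (fun x => (mw_pos D α x).ne')

lemma qf_sub (D : GelfandData) (α : ℝ) {g h : ℝ → ℝ} (hg : Continuous g) (hh : Continuous h) (s : ℝ) :
    qf D α g s - qf D α h s = qf D α (fun t => g t - h t) s := by
  by_cases hs : s = 0
  · subst hs
    rw [qf_zero D α hg, qf_zero D α hh, qf_zero D α (show Continuous (fun t => g t - h t) from hg.sub hh)]; simp
  · rw [qf_eq D α _ hs, qf_eq D α _ hs, qf_eq D α _ hs, ← sub_div]
    congr 1
    unfold Hf
    rw [← intervalIntegral.integral_sub ((Hint_cont D α hg).intervalIntegrable _ _)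
      ((Hint_cont D α hh).intervalIntegrable _ _)]
    congr 1; ext t; ring

lemma Hf_bound1 (D : GelfandData) {α : ℝ} (hα : 0 < α) {g : ℝ → ℝ} {A : ℝ} (hA : 0 ≤ A)
    (hb : ∀ t ∈ Icc (0:ℝ) 1, |g t| ≤ A * pse D t) {s : ℝ} (hs : s ∈ Ioo (0:ℝ) 1) :
    |Hf D α g s| ≤ A * s^2 * mw D α s := by
  have := intervalIntegral.norm_integral_le_of_norm_le (μ := volume)
    (f := fun t => g t * (t * mw D α t)) (g := fun t => A * s * mw D α s) hs.1.le
    (Eventually.of_forall (fun t ht => by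
      rw [Real.norm_eq_abs, abs_mul, abs_of_nonneg (mul_nonneg ht.1.le (mw_pos D α t).le)]
      have h1 := hb t ⟨ht.1.le, ht.2.trans hs.2.le⟩
      have h2 : |g t| ≤ A := h1.trans (mul_le_of_le_one_right hA (pse_le D t))
      have h3 := mw_mono D hα.le ht.1.le ht.2
      have h4 := ht.1.le
      have h5 := (mw_pos D α t).le
      have h6 : 0 ≤ s := hs.1.le
      have h7 := ht.2
      rw [mul_assoc]
      gcongr)) (by simp)
  rw [intervalIntegral.integral_const] at this
  unfold Hf
  simp only [Real.norm_eq_abs, smul_eq_mul] at this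
  linarith [this, show (s - 0) * (A * s * mw D α s) = A * s^2 * mw D α s by ring]

lemma Hf_bound2 (D : GelfandData) {α : ℝ} (hα : 0 < α) {g : ℝ → ℝ} {A : ℝ} (hA : 0 ≤ A)
    (hb : ∀ t ∈ Icc (0:ℝ) 1, |g t| ≤ A * pse D t) {s : ℝ} (hs : s ∈ Ioo (0:ℝ) 1) :
    |Hf D α g s| ≤ A * D.M s / α * mw D α s := by
  have hs' : s ∈ Ico (0:ℝ) 1 := ⟨hs.1.le, hs.2⟩
  have hc : Continuous (fun t => A * D.M s / α * (α * (t * phe D t) * mw D α t)) :=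
    continuous_const.mul ((continuous_const.mul (continuous_id.mul (phe_cont D))).mul (mw_cont D α))
  have := intervalIntegral.norm_integral_le_of_norm_le (μ := volume)
    (f := fun t => g t * (t * mw D α t))
    (g := fun t => A * D.M s / α * (α * (t * phe D t) * mw D α t)) hs.1.le
    (Eventually.of_forall (fun t ht => by
      rw [Real.norm_eq_abs, abs_mul, abs_of_nonneg (mul_nonneg ht.1.le (mw_pos D α t).le)]
      have h1 := hb t ⟨ht.1.le, ht.2.trans hs.2.le⟩
      have h2 := M_ge D hs' (t := t) ⟨ht.1.le, ht.2⟩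
      have h4 := ht.1.le
      have h5 := (mw_pos D α t).le
      have h6 : |g t| ≤ A * (D.M s * phe D t) := h1.trans (by gcongr)
      calc |g t| * (t * mw D α t) ≤ (A * (D.M s * phe D t)) * (t * mw D α t) := by gcongr
        _ = _ := by field_simp)) (hc.intervalIntegrable _ _)
  rw [intervalIntegral.integral_eq_sub_of_hasDerivAt
    (f := fun t => A * D.M s / α * mw D α t)
    (fun x _ => (mw_deriv D α x).const_mul _) (hc.intervalIntegrable _ _)] at this
  refine this.trans ?_
  rw [mw_zero]
  have := M_one D hs'
  have : 0 ≤ A * D.M s / α * 1 := by positivity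
  linarith

noncomputable def bnd (D : GelfandData) (α s : ℝ) : ℝ :=
  2 * D.M (1/2) * (s / (1 + α * s^2)) + 2 / α * D.M s

lemma qf_bound (D : GelfandData) {α : ℝ} (hα : 0 < α) {g : ℝ → ℝ} {A : ℝ} (hA : 0 ≤ A)
    (hb : ∀ t ∈ Icc (0:ℝ) 1, |g t| ≤ A * pse D t) {s : ℝ} (hs : s ∈ Ioo (0:ℝ) 1) :
    |qf D α g s| ≤ A * bnd D α s := by
  have hs' : s ∈ Ico (0:ℝ) 1 := ⟨hs.1.le, hs.2⟩
  have s0 : 0 < s := hs.1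
  have hm := mw_pos D α s
  have hM := M_one D hs'
  have hM2 := M_one D (s := 1/2) (by norm_num)
  have b1 : |qf D α g s| ≤ A * s := by
    rw [qf_eq D α g s0.ne', abs_div, abs_of_pos (mul_pos s0 hm), div_le_iff₀ (mul_pos s0 hm)]
    linarith [Hf_bound1 D hα hA hb hs, show A * s * (s * mw D α s) = A * s^2 * mw D α s by ring]
  have b2 : |qf D α g s| ≤ A * (D.M s / (α * s)) := by
    rw [qf_eq D α g s0.ne', abs_div, abs_of_pos (mul_pos s0 hm), div_le_iff₀ (mul_pos s0 hm)]
    refine (Hf_bound2 D hα hA hb hs).trans (le_of_eq ?_)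
    field_simp
  unfold bnd
  have p1 : 0 ≤ 2 / α * D.M s := by positivity
  have p2 : 0 ≤ 2 * D.M (1/2) * (s / (1 + α * s^2)) := by positivity
  by_cases h : s ≤ 1/2
  · by_cases h2 : α * s^2 ≤ 1
    · refine b1.trans (mul_le_mul_of_nonneg_left ?_ hA)
      have : s ≤ 2 * D.M (1/2) * (s / (1 + α * s^2)) := by
        rw [← mul_div_assoc, le_div_iff₀ (by positivity)]
        nlinarith
      linarith
    · push Not at h2
      refine b2.trans (mul_le_mul_of_nonneg_left ?_ hA)
      have h3 : D.M s ≤ D.M (1/2) := M_mono D (by norm_num) ⟨s0.le, h⟩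
      have : D.M s / (α * s) ≤ 2 * D.M (1/2) * (s / (1 + α * s^2)) := by
        rw [← mul_div_assoc, div_le_div_iff₀ (by positivity) (by positivity)]
        have : 1 + α * s^2 ≤ 2 * (α * s^2) := by linarith
        calc D.M s * (1 + α * s^2) ≤ D.M (1/2) * (2 * (α * s^2)) := by gcongr
          _ = _ := by ring
      linarith
  · push Not at h
    refine b2.trans (mul_le_mul_of_nonneg_left ?_ hA)
    have : D.M s / (α * s) ≤ 2 / α * D.M s := by
      rw [div_le_iff₀ (by positivity)]
      have : 2 / α * D.M s * (α * s) = D.M s * (2 * s) := by field_simp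
      rw [this]
      nlinarith
    linarith

lemma bnd_ii (D : GelfandData) {α : ℝ} (hα : 0 < α) {r : ℝ} (hr : 0 ≤ r) (hr1 : r ≤ 1) :
    IntervalIntegrable (bnd D α) volume r 1 := by
  unfold bnd
  apply IntervalIntegrable.add
  · apply Continuous.intervalIntegrable
    apply continuous_const.mul
    apply continuous_id.div (by fun_prop)
    intro x; positivity
  · exact (M_ii D hr hr1 le_rfl).const_mul _

lemma bnd_integral (D : GelfandData) : ∃ C : ℝ, 0 < C ∧ ∀ α : ℝ, 3 ≤ α → ∀ r ∈ Icc (0:ℝ) 1,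
    ∫ s in r..1, bnd D α s ≤ C * Real.log α / α := by
  have hM2 := M_one D (s := 1/2) (by norm_num)
  have hI : 0 ≤ ∫ s in (0:ℝ)..1, D.M s := by
    have := M_integral_le D (a := 1) zero_le_one le_rfl
    simpa using this
  refine ⟨2 * D.M (1/2) + 2 * ∫ s in (0:ℝ)..1, D.M s, by positivity, fun α hα r hr => ?_⟩
  have a0 : 0 < α := by linarith
  have hlog : 1 ≤ Real.log α := by
    rw [Real.le_log_iff_exp_le a0]
    linarith [Real.exp_one_lt_d9]
  have hlog2 : Real.log (1 + α) ≤ 2 * Real.log α := by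
    rw [← Real.log_rpow a0]
    apply Real.log_le_log (by positivity)
    norm_num
    nlinarith
  have hcc : Continuous (fun s : ℝ => s / (1 + α * s^2)) := by
    apply continuous_id.div (by fun_prop)
    intro x; positivity
  unfold bnd
  have hcc2 : Continuous (fun s : ℝ => 2 * D.M (1/2) * (s / (1 + α * s^2))) :=
    continuous_const.mul hcc
  rw [intervalIntegral.integral_add (hcc2.intervalIntegrable _ _)
    ((M_ii D hr.1 hr.2 le_rfl).const_mul _), intervalIntegral.integral_const_mul,
    intervalIntegral.integral_const_mul]
  have e1 : ∫ s in r..1, s / (1 + α * s^2) = Real.log (1 + α) / (2 * α) - Real.log (1 + α * r^2) / (2 * α) := by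
    rw [intervalIntegral.integral_eq_sub_of_hasDerivAt
      (f := fun s => Real.log (1 + α * s^2) / (2 * α))
      (fun x _ => by
        have h0 : (1 + α * x^2) ≠ 0 := by positivity
        have h1 : HasDerivAt (fun s : ℝ => 1 + α * s^2) (α * (2 * x)) x := by
          have := (((hasDerivAt_id x).pow 2).const_mul α).const_add 1
          refine this.congr_deriv ?_
          simp
        refine ((h1.log h0).div_const (2 * α)).congr_deriv ?_
        field_simp) (hcc.intervalIntegrable _ _)]
    simp
  have e2 : 0 ≤ Real.log (1 + α * r^2) := Real.log_nonneg (by nlinarith [sq_nonneg r])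
  have e3 := M_integral_le D hr.1 hr.2
  rw [e1]
  have s1 : 2 * D.M (1/2) * (Real.log (1 + α) / (2 * α) - Real.log (1 + α * r^2) / (2 * α))
      ≤ 2 * D.M (1/2) * Real.log α / α := by
    rw [← sub_div, mul_div_assoc]
    apply mul_le_mul_of_nonneg_left _ (by positivity)
    rw [div_le_div_iff₀ (by positivity) a0]
    nlinarith
  have s2 : 2 / α * (∫ s in r..1, D.M s) ≤ 2 * (∫ s in (0:ℝ)..1, D.M s) * Real.log α / α := by
    rw [div_mul_eq_mul_div]
    apply div_le_div_of_nonneg_right _ a0.le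
    nlinarith
  calc _ ≤ _ := add_le_add s1 s2
    _ = _ := by ring

lemma qf_integral (D : GelfandData) : ∃ C : ℝ, 0 < C ∧ ∀ α : ℝ, 3 ≤ α → ∀ (g : ℝ → ℝ) (A : ℝ),
    Continuous g → 0 ≤ A → (∀ t ∈ Icc (0:ℝ) 1, |g t| ≤ A * pse D t) → ∀ r ∈ Icc (0:ℝ) 1,
    |∫ s in r..1, qf D α g s| ≤ A * (C * Real.log α / α) := by
  obtain ⟨C, hC, h⟩ := bnd_integral D
  refine ⟨C, hC, fun α hα g A hg hA hb r hr => ?_⟩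
  have a0 : 0 < α := by linarith
  refine (intervalIntegral.abs_integral_le_integral_abs hr.2).trans ?_
  refine (intervalIntegral.integral_mono_on_of_le_Ioo hr.2
    ((qf_cont D α hg).abs.intervalIntegrable _ _)
    ((bnd_ii D a0 hr.1 hr.2).const_mul A) (fun x hx =>
      qf_bound D a0 hA hb ⟨hr.1.trans_lt hx.1, hx.2⟩)).trans ?_
  rw [intervalIntegral.integral_const_mul]
  exact mul_le_mul_of_nonneg_left (h α hα r hr) hA

noncomputable def Uf (D : GelfandData) (α lam : ℝ) (g : ℝ → ℝ) (r : ℝ) : ℝ :=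
  -lam * ∫ s in (1:ℝ)..r, qf D α g s

lemma Uf_eq (D : GelfandData) (α lam : ℝ) (g : ℝ → ℝ) (r : ℝ) :
    Uf D α lam g r = lam * ∫ s in r..1, qf D α g s := by
  unfold Uf; rw [intervalIntegral.integral_symm]; ring

lemma Uf_deriv (D : GelfandData) (α lam : ℝ) {g : ℝ → ℝ} (hg : Continuous g) (r : ℝ) :
    HasDerivAt (Uf D α lam g) (-lam * qf D α g r) r :=
  ((qf_cont D α hg).integral_hasStrictDerivAt 1 r).hasDerivAt.const_mul _

lemma Uf_cont (D : GelfandData) (α lam : ℝ) {g : ℝ → ℝ} (hg : Continuous g) :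
    Continuous (Uf D α lam g) :=
  continuous_iff_continuousAt.2 (fun r => (Uf_deriv D α lam hg r).continuousAt)

noncomputable def gw (D : GelfandData) (w : C(Icc (0:ℝ) 1, ℝ)) (t : ℝ) : ℝ :=
  pse D t * fe D (w (projIcc 0 1 zero_le_one t))

lemma gw_cont (D : GelfandData) (w : C(Icc (0:ℝ) 1, ℝ)) : Continuous (gw D w) :=
  (pse_cont D).mul ((fe_cont D).comp (w.continuous.comp continuous_projIcc))

noncomputable def Tm (D : GelfandData) (α lam : ℝ) (w : C(Icc (0:ℝ) 1, ℝ)) : C(Icc (0:ℝ) 1, ℝ) :=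
  ⟨fun r => Uf D α lam (gw D w) r, (Uf_cont D α lam (gw_cont D w)).comp continuous_subtype_val⟩

lemma psi_half (D : GelfandData) : ∃ s0 : ℝ, 0 < s0 ∧ s0 ≤ 1/2 ∧ ∀ t ∈ Icc 0 s0, 1/2 ≤ pse D t := by
  have h : Tendsto (pse D) (nhds 0) (nhds (pse D 0)) := (pse_cont D).tendsto 0
  have h0 : pse D 0 = 1 := by rw [pse_eq D (by simp), D.psi_zero]
  rw [h0] at h
  have h2 := h.eventually (lt_mem_nhds (show (1/2:ℝ) < 1 by norm_num))
  obtain ⟨ε, hε, hb⟩ := Metric.eventually_nhds_iff.1 h2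
  refine ⟨min (ε/2) (1/2), by positivity, min_le_right _ _, fun t ht => (hb ?_).le⟩
  rw [Real.dist_eq, sub_zero, abs_of_nonneg ht.1]
  have := ht.2.trans (min_le_left _ _)
  linarith

lemma Hf_pos (D : GelfandData) (α : ℝ) (w : C(Icc (0:ℝ) 1, ℝ)) {s : ℝ} (hs : 0 < s) :
    0 < Hf D α (gw D w) s := by
  obtain ⟨s0, hs0, hs1, hp⟩ := psi_half D
  have hd := fun x => Hf_deriv D α (gw_cont D w) x
  have hnn : ∀ x, 0 ≤ x → 0 ≤ gw D w x * (x * mw D α x) := fun x hx => by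
    have := mw_pos D α x
    have := pse_nonneg D x
    have := fe_pos D (w (projIcc 0 1 zero_le_one x))
    unfold gw
    positivity
  have h1 : 0 < Hf D α (gw D w) (min s s0) := by
    unfold Hf
    apply intervalIntegral.intervalIntegral_pos_of_pos_on
      ((Hint_cont D α (gw_cont D w)).intervalIntegrable _ _) _ (lt_min hs hs0)
    intro x hx
    have := mw_pos D α x
    have hx0 := hx.1
    have : 0 < pse D x := by
      have := hp x ⟨hx.1.le, hx.2.le.trans (min_le_right _ _)⟩
      linarith
    have := fe_pos D (w (projIcc 0 1 zero_le_one x))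
    unfold gw
    positivity
  refine h1.trans_le (le_of_hasDeriv (min_le_left _ _)
    (fun x _ => (hd x).continuousAt.continuousWithinAt) (fun x _ => hd x) (fun x hx => hnn x ?_))
  exact (lt_min hs hs0).le.trans hx.1.le

lemma fixed_sol (D : GelfandData) {α lam : ℝ} (hl : 0 < lam)
    (w : C(Icc (0:ℝ) 1, ℝ)) (hw : Tm D α lam w = w)
    (hw1 : ∀ r ∈ Icc (0:ℝ) 1, Uf D α lam (gw D w) r ≤ 1) :
    IsSolution D α lam (Uf D α lam (gw D w)) := by
  set g := gw D w with hg
  have gc : Continuous g := gw_cont D w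
  set u := Uf D α lam g with hu
  have ud : ∀ r, HasDerivAt u (-lam * qf D α g r) r := fun r => Uf_deriv D α lam gc r
  have udw : ∀ r ∈ Icc (0:ℝ) 1, derivWithin u (Icc 0 1) r = -lam * qf D α g r := fun r hr =>
    (ud r).hasDerivWithinAt.derivWithin (uniqueDiffOn_Icc zero_lt_one r hr)
  have qpos : ∀ s, 0 < s → 0 < qf D α g s := fun s hs => by
    rw [qf_eq D α g hs.ne']
    exact div_pos (Hf_pos D α w hs) (mul_pos hs (mw_pos D α s))
  have upos : ∀ r ∈ Ico (0:ℝ) 1, 0 < u r := fun r hr => by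
    rw [hu, Uf_eq]
    apply mul_pos hl
    apply intervalIntegral.intervalIntegral_pos_of_pos_on
      ((qf_cont D α gc).intervalIntegrable _ _) _ hr.2
    intro x hx
    exact qpos x (hr.1.trans_lt hx.1)
  have wu : ∀ r (hr : r ∈ Icc (0:ℝ) 1), w ⟨r, hr⟩ = u r := fun r hr => by
    conv_lhs => rw [← hw]
    rfl
  have qd : ∀ r ∈ Ioo (0:ℝ) 1, HasDerivAt (fun s => -lam * (Hf D α g s / (s * mw D α s)))
      (-lam * (((g r * (r * mw D α r)) * (r * mw D α r) - Hf D α g r *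
        (1 * mw D α r + r * (α * (r * phe D r) * mw D α r))) / (r * mw D α r)^2)) r := fun r hr =>
    ((Hf_deriv D α gc r).div ((hasDerivAt_id r).mul (mw_deriv D α r))
      (mul_pos hr.1 (mw_pos D α r)).ne').const_mul _
  refine ⟨?_, ?_, upos, ?_, ?_, ?_⟩
  · apply ContDiff.contDiffOn
    rw [contDiff_one_iff_deriv]
    refine ⟨fun r => (ud r).differentiableAt, ?_⟩
    have : deriv u = fun r => -lam * qf D α g r := funext (fun r => (ud r).deriv)
    rw [this]
    exact continuous_const.mul (qf_cont D α gc)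
  · have h2 : (2 : WithTop ℕ∞) = 1 + 1 := by norm_num
    rw [h2, contDiffOn_succ_iff_deriv_of_isOpen isOpen_Ioo]
    refine ⟨fun r _ => (ud r).differentiableAt.differentiableWithinAt, by simp, ?_⟩
    have hH : ContDiff ℝ 1 (Hf D α g) := by
      rw [contDiff_one_iff_deriv]
      refine ⟨fun r => (Hf_deriv D α gc r).differentiableAt, ?_⟩
      rw [show deriv (Hf D α g) = fun s => g s * (s * mw D α s) from
        funext (fun r => (Hf_deriv D α gc r).deriv)]
      exact Hint_cont D α gc
    have hm : ContDiff ℝ 1 (mw D α) := by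
      rw [contDiff_one_iff_deriv]
      refine ⟨fun r => (mw_deriv D α r).differentiableAt, ?_⟩
      rw [show deriv (mw D α) = fun r => α * (r * phe D r) * mw D α r from
        funext (fun r => (mw_deriv D α r).deriv)]
      exact (continuous_const.mul (continuous_id.mul (phe_cont D))).mul (mw_cont D α)
    have : ContDiffOn ℝ 1 (fun s => -lam * (Hf D α g s / (s * mw D α s))) (Ioo 0 1) :=
      contDiffOn_const.mul (hH.contDiffOn.div (contDiffOn_id.mul hm.contDiffOn)
        (fun x hx => (mul_pos hx.1 (mw_pos D α x)).ne'))
    refine this.congr (fun x hx => ?_)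
    rw [(ud x).deriv, qf_eq D α g hx.1.ne']
  · rw [udw 0 (by simp), qf_zero D α gc, mul_zero]
  · rw [hu, Uf_eq]; simp
  · intro r hr
    have hr' : r ∈ Icc (0:ℝ) 1 := Ioo_subset_Icc_self hr
    have e : derivWithin (derivWithin u (Icc 0 1)) (Ioo 0 1) r =
        -lam * (((g r * (r * mw D α r)) * (r * mw D α r) - Hf D α g r *
        (1 * mw D α r + r * (α * (r * phe D r) * mw D α r))) / (r * mw D α r)^2) := by
      rw [derivWithin_of_isOpen isOpen_Ioo hr]
      refine HasDerivAt.deriv ((qd r hr).congr_of_eventuallyEq ?_)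
      filter_upwards [isOpen_Ioo.mem_nhds hr] with x hx
      rw [udw x (Ioo_subset_Icc_self hx), qf_eq D α g hx.1.ne']
    rw [e, udw r hr', qf_eq D α g hr.1.ne', ← phe_eq D hr', ← pse_eq D hr']
    have gr : g r = pse D r * D.f (u r) := by
      rw [hg]; unfold gw
      rw [projIcc_of_mem zero_le_one hr', wu r hr']
      unfold fe
      rw [cl_eq ⟨(upos r ⟨hr.1.le, hr.2⟩).le, hw1 r hr'⟩]
    rw [gr]
    have := (mw_pos D α r).ne'
    have := hr.1.ne'
    field_simp
    ring

lemma exists_sol (D : GelfandData) : ∃ c0 : ℝ, 0 < c0 ∧ ∀ α : ℝ, 3 ≤ α →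
    c0 * α / Real.log α ∈ solvableSet D α := by
  obtain ⟨C, hC, hq⟩ := qf_integral D
  obtain ⟨L, hL, hlip⟩ := fe_lip D
  have hf1 := D.f_pos 1 zero_le_one
  set c0 := 1 / (2 * C * (L + D.f 1)) with hc0
  have c0pos : 0 < c0 := by positivity
  refine ⟨c0, c0pos, fun α hα => ?_⟩
  have a0 : 0 < α := by linarith
  have hlog : 0 < Real.log α := Real.log_pos (by linarith)
  set lam := c0 * α / Real.log α with hlam
  have lpos : 0 < lam := by positivity
  have key : ∀ A, lam * (A * (C * Real.log α / α)) = A / (2 * (L + D.f 1)) := fun A => by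
    rw [hlam, hc0]; field_simp
  have Ub : ∀ (g : ℝ → ℝ) (A : ℝ), Continuous g → 0 ≤ A →
      (∀ t ∈ Icc (0:ℝ) 1, |g t| ≤ A * pse D t) → ∀ r ∈ Icc (0:ℝ) 1,
      |Uf D α lam g r| ≤ A / (2 * (L + D.f 1)) := fun g A hg hA hb r hr => by
    rw [Uf_eq, abs_mul, abs_of_pos lpos, ← key]
    exact mul_le_mul_of_nonneg_left (hq α hα g A hg hA hb r hr) lpos.le
  have hcon : ContractingWith (1/2 : NNReal) (Tm D α lam) := by
    refine ⟨by norm_num, LipschitzWith.of_dist_le_mul (fun w1 w2 => ?_)⟩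
    rw [ContinuousMap.dist_le (by positivity)]
    intro r
    have c1 := gw_cont D w1
    have c2 := gw_cont D w2
    have h := Ub (fun t => gw D w1 t - gw D w2 t) (L * dist w1 w2) (c1.sub c2) (by positivity)
      (fun t ht => by
        unfold gw
        rw [← mul_sub, abs_mul, abs_of_nonneg (pse_nonneg D t), mul_comm]
        apply mul_le_mul_of_nonneg_right _ (pse_nonneg D t)
        refine (hlip _ _).trans (mul_le_mul_of_nonneg_left ?_ hL.le)
        rw [← Real.dist_eq]
        exact ContinuousMap.dist_apply_le_dist _) r r.2
    have e : Uf D α lam (fun t => gw D w1 t - gw D w2 t) r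
        = Uf D α lam (gw D w1) r - Uf D α lam (gw D w2) r := by
      rw [Uf_eq, Uf_eq, Uf_eq, ← mul_sub, ← intervalIntegral.integral_sub
        ((qf_cont D α c1).intervalIntegrable _ _) ((qf_cont D α c2).intervalIntegrable _ _)]
      congr 2; ext s; exact (qf_sub D α c1 c2 s).symm
    rw [e] at h
    rw [Real.dist_eq]
    refine h.trans ?_
    have hd : 0 ≤ dist w1 w2 := dist_nonneg
    rw [div_le_iff₀ (by positivity)]
    push_cast
    nlinarith [mul_nonneg hd hf1.le]
  have hfp := hcon.fixedPoint_isFixedPt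
  refine ⟨lpos, _, fixed_sol D lpos _ hfp ?_⟩
  intro r hr
  refine (le_abs_self _).trans ((Ub _ (D.f 1) (gw_cont D _) hf1.le (fun t _ => ?_) r hr).trans ?_)
  · unfold gw
    rw [abs_mul, abs_of_nonneg (pse_nonneg D t), abs_of_pos (fe_pos D _), mul_comm]
    exact mul_le_mul_of_nonneg_right (fe_le D _) (pse_nonneg D t)
  · rw [div_le_one (by positivity)]
    linarith

/-- the flux `-r μ u'` -/
noncomputable def pf (D : GelfandData) (α : ℝ) (v : ℝ → ℝ) (r : ℝ) : ℝ := -(r * mw D α r * v r)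

/-- consequences of being a solution -/
structure Facts (D : GelfandData) (α lam : ℝ) (u v : ℝ → ℝ) : Prop where
  uc : ContinuousOn u (Icc 0 1)
  vc : ContinuousOn v (Icc 0 1)
  ud : ∀ r ∈ Ioo (0:ℝ) 1, HasDerivAt u (v r) r
  pc : ContinuousOn (pf D α v) (Icc 0 1)
  pd : ∀ r ∈ Ioo (0:ℝ) 1,
    HasDerivAt (pf D α v) (lam * pse D r * D.f (u r) * (r * mw D α r)) r
  upos : ∀ r ∈ Ico (0:ℝ) 1, 0 < u r
  u1 : u 1 = 0
  pmono : ∀ a b, 0 ≤ a → a ≤ b → b ≤ 1 → pf D α v a ≤ pf D α v b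
  anti : ∀ a b, 0 ≤ a → a ≤ b → b ≤ 1 → u b ≤ u a

lemma facts_of_sol (D : GelfandData) {α lam : ℝ} {u : ℝ → ℝ} (hl : 0 < lam)
    (h : IsSolution D α lam u) : Facts D α lam u (derivWithin u (Icc 0 1)) := by
  obtain ⟨h1, h2, upos, v0, u1, ode⟩ := h
  set v := derivWithin u (Icc 0 1) with hv
  have uc := h1.continuousOn
  have vc : ContinuousOn v (Icc 0 1) :=
    h1.continuousOn_derivWithin (uniqueDiffOn_Icc zero_lt_one) le_rfl
  have ud : ∀ r ∈ Ioo (0:ℝ) 1, HasDerivAt u (v r) r := fun r hr =>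
    ((h1.differentiableOn one_ne_zero) r (Ioo_subset_Icc_self hr)).hasDerivWithinAt.hasDerivAt
      (Icc_mem_nhds hr.1 hr.2)
  have vd : DifferentiableOn ℝ v (Ioo 0 1) := by
    have e2 : (2 : WithTop ℕ∞) = 1 + 1 := by norm_num
    rw [e2, contDiffOn_succ_iff_deriv_of_isOpen isOpen_Ioo] at h2
    refine (h2.2.2.differentiableOn one_ne_zero).congr (fun x hx => ?_)
    exact (ud x hx).deriv.symm
  have vd' : ∀ r ∈ Ioo (0:ℝ) 1, HasDerivAt v (derivWithin v (Ioo 0 1) r) r := fun r hr =>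
    (vd r hr).hasDerivWithinAt.hasDerivAt (isOpen_Ioo.mem_nhds hr)
  have pc : ContinuousOn (pf D α v) (Icc 0 1) :=
    ((continuous_id.mul (mw_cont D α)).continuousOn.mul vc).neg
  have pd : ∀ r ∈ Ioo (0:ℝ) 1,
      HasDerivAt (pf D α v) (lam * pse D r * D.f (u r) * (r * mw D α r)) r := fun r hr => by
    have h := ((((hasDerivAt_id r).mul (mw_deriv D α r)).mul (vd' r hr))).neg
    refine h.congr_deriv ?_
    have hr' := Ioo_subset_Icc_self hr
    have o := ode r hr
    rw [← phe_eq D hr', ← pse_eq D hr'] at o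
    rw [← o]
    have := hr.1.ne'
    simp only [id, Pi.mul_apply]
    field_simp
    ring
  have unn : ∀ r ∈ Icc (0:ℝ) 1, 0 ≤ u r := fun r hr => by
    rcases hr.2.lt_or_eq with h | h
    · exact (upos r ⟨hr.1, h⟩).le
    · rw [h, u1]
  have pmono : ∀ a b, 0 ≤ a → a ≤ b → b ≤ 1 → pf D α v a ≤ pf D α v b := fun a b ha hab hb => by
    refine le_of_hasDeriv hab (pc.mono (Icc_subset_Icc ha hb))
      (fun x hx => pd x ⟨ha.trans_lt hx.1, hx.2.trans_le hb⟩) (fun x hx => ?_)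
    have hx0 : 0 < x := ha.trans_lt hx.1
    have := pse_nonneg D x
    have := mw_pos D α x
    have := D.f_pos (u x) (unn x ⟨hx0.le, hx.2.le.trans hb⟩)
    positivity
  refine ⟨uc, vc, ud, pc, pd, upos, u1, pmono, fun a b ha hab hb => ?_⟩
  have := le_of_hasDeriv (g := fun x => - u x) (g' := fun x => - v x) hab
    (uc.mono (Icc_subset_Icc ha hb)).neg
    (fun x hx => (ud x ⟨ha.trans_lt hx.1, hx.2.trans_le hb⟩).neg) (fun x hx => by
      have hx0 : 0 < x := ha.trans_lt hx.1
      have := pmono 0 x le_rfl hx0.le (hx.2.le.trans hb)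
      unfold pf at this
      simp only [zero_mul, neg_zero] at this
      have hm := mul_pos hx0 (mw_pos D α x)
      by_contra hc
      push Not at hc
      nlinarith)
  linarith

lemma Facts.lower {D : GelfandData} {α lam : ℝ} {u v : ℝ → ℝ} (F : Facts D α lam u v)
    (hα : 0 < α) (hl : 0 < lam) {s0 : ℝ} (hs1 : s0 ≤ 1/2)
    (hp : ∀ t ∈ Icc 0 s0, 1/2 ≤ pse D t) {r : ℝ} (hr : 0 < r) (hrs : r ≤ s0) :
    lam / (2 * α) * D.f (u r) * (mw D α r - 1) ≤ pf D α v r := by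
  have hr1 : r < 1 := by linarith
  have hur := F.upos r ⟨hr.le, hr1⟩
  have fpos := D.f_pos _ hur.le
  have h := le_of_hasDeriv (g := fun x => pf D α v x - lam / (2 * α) * D.f (u r) * mw D α x)
    hr.le ((F.pc.mono (Icc_subset_Icc le_rfl hr1.le)).sub
      (continuous_const.mul (mw_cont D α)).continuousOn)
    (fun x hx => (F.pd x ⟨hx.1, hx.2.trans hr1⟩).sub ((mw_deriv D α x).const_mul _))
    (fun x hx => by
      have hm := mul_pos hx.1 (mw_pos D α x)
      have h1 := hp x ⟨hx.1.le, hx.2.le.trans hrs⟩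
      have h2 : D.f (u r) ≤ D.f (u x) := D.f_mono hur.le
        (F.upos x ⟨hx.1.le, hx.2.trans hr1⟩).le (F.anti x r hx.1.le hx.2.le hr1.le)
      have h3 := phe_le D x
      have e : lam / (2 * α) * D.f (u r) * (α * (x * phe D x) * mw D α x)
        = lam * (1/2) * D.f (u r) * (x * mw D α x) * phe D x := by field_simp
      rw [e, sub_nonneg]
      calc lam * (1/2) * D.f (u r) * (x * mw D α x) * phe D x
          ≤ lam * (1/2) * D.f (u r) * (x * mw D α x) * 1 := by gcongr
        _ ≤ lam * pse D x * D.f (u x) * (x * mw D α x) * 1 := by gcongr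
        _ = _ := by ring)
  have e0 : pf D α v 0 = 0 := by simp [pf]
  rw [e0, mw_zero] at h
  linarith

noncomputable def FF (D : GelfandData) (x : ℝ) : ℝ := ∫ t in (0:ℝ)..x, 1 / D.f t

lemma FF_deriv (D : GelfandData) {x : ℝ} (hx : 0 < x) : HasDerivAt (FF D) (1 / D.f x) x := by
  have hc : ContinuousOn (fun t => 1 / D.f t) (Ici 0) :=
    continuousOn_const.div D.f_smooth.continuousOn (fun t ht => (D.f_pos t ht).ne')
  apply intervalIntegral.integral_hasDerivAt_right
  · apply ContinuousOn.intervalIntegrable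
    rw [uIcc_of_le hx.le]
    exact hc.mono Icc_subset_Ici_self
  · exact (hc.mono Ioi_subset_Ici_self).stronglyMeasurableAtFilter isOpen_Ioi x hx
  · exact (hc.continuousAt (Ici_mem_nhds hx))

lemma FF_tendsto (D : GelfandData) : Tendsto (FF D) atTop (nhds D.K) := by
  rw [D.K_def]
  exact intervalIntegral_tendsto_integral_Ioi 0 D.f_int tendsto_id

lemma FF_mono (D : GelfandData) {x y : ℝ} (hx : 0 < x) (hxy : x ≤ y) : FF D x ≤ FF D y :=
  le_of_hasDeriv hxy (fun z hz => (FF_deriv D (hx.trans_le hz.1)).continuousAt.continuousWithinAt)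
    (fun z hz => FF_deriv D (hx.trans hz.1)) (fun z hz => by
      have := D.f_pos z (hx.trans hz.1).le
      positivity)

lemma FF_le (D : GelfandData) {x : ℝ} (hx : 0 < x) : FF D x ≤ D.K :=
  ge_of_tendsto (FF_tendsto D) (by
    filter_upwards [eventually_ge_atTop x] with y hy
    exact FF_mono D hx hy)

lemma FF_nonneg (D : GelfandData) {x : ℝ} (hx : 0 < x) : 0 ≤ FF D x := by
  apply intervalIntegral.integral_nonneg hx.le
  intro t ht
  have := D.f_pos t ht.1
  positivity

noncomputable def kap (D : GelfandData) : ℝ := 1 - Real.exp (-(D.phi (1/2) / 2))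

lemma kap_pos (D : GelfandData) : 0 < kap D := by
  unfold kap
  have := D.phi_pos (1/2) (by norm_num)
  have : Real.exp (-(D.phi (1/2) / 2)) < 1 := by
    rw [Real.exp_lt_one_iff]; linarith
  linarith

lemma mw_kap (D : GelfandData) {α r : ℝ} (hα : 0 < α) (hr : 0 < r) (hr1 : r ≤ 1/2)
    (h : 1 ≤ α * r^2) : kap D * mw D α r ≤ mw D α r - 1 := by
  have h1 := mw_lower D hα.le le_rfl hr.le hr1
  rw [mw_zero, one_mul] at h1
  have hp := D.phi_pos (1/2) (by norm_num)
  have h2 : Real.exp (D.phi (1/2) / 2) ≤ mw D α r := by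
    refine le_trans (Real.exp_le_exp.2 ?_) h1
    nlinarith
  unfold kap
  have h3 : Real.exp (-(D.phi (1/2) / 2)) * Real.exp (D.phi (1/2) / 2) = 1 := by
    rw [← Real.exp_add]; simp
  have h4 := Real.exp_pos (-(D.phi (1/2) / 2))
  nlinarith

lemma Facts.FFgap {D : GelfandData} {α lam : ℝ} {u v : ℝ → ℝ} (F : Facts D α lam u v)
    (hα : 0 < α) (hl : 0 < lam) {s0 : ℝ} (hs1 : s0 ≤ 1/2)
    (hp : ∀ t ∈ Icc 0 s0, 1/2 ≤ pse D t) {a b : ℝ} (ha : 0 < a) (hab : a ≤ b) (hb : b ≤ s0)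
    (h1 : 1 ≤ α * a^2) :
    lam * kap D / (2 * α) * (Real.log b - Real.log a) ≤ FF D (u a) - FF D (u b) := by
  have hd : ∀ x ∈ Icc a b, HasDerivAt
      (fun x => - FF D (u x) - lam * kap D / (2 * α) * Real.log x)
      (-(1 / D.f (u x) * v x) - lam * kap D / (2 * α) * x⁻¹) x := fun x hx => by
    have hx0 : 0 < x := ha.trans_le hx.1
    have hx1 : x < 1 := by linarith [hx.2]
    have d1 := (FF_deriv D (F.upos x ⟨hx0.le, hx1⟩)).comp x (F.ud x ⟨hx0, hx1⟩)
    exact d1.neg.sub ((Real.hasDerivAt_log hx0.ne').const_mul _)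
  have := le_of_hasDeriv hab (fun x hx => (hd x hx).continuousAt.continuousWithinAt)
    (fun x hx => hd x (Ioo_subset_Icc_self hx)) (fun x hx => by
      have hx0 : 0 < x := ha.trans hx.1
      have hxs : x ≤ s0 := hx.2.le.trans hb
      have fpos := D.f_pos (u x) (F.upos x ⟨hx0.le, by linarith⟩).le
      have l := F.lower hα hl hs1 hp hx0 hxs
      have k := mw_kap D hα hx0 (hxs.trans hs1) (h1.trans (by gcongr; exact hx.1.le))
      have hm := mw_pos D α x
      have l2 : lam / (2 * α) * D.f (u x) * (kap D * mw D α x) ≤ pf D α v x :=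
        le_trans (by gcongr) l
      unfold pf at l2
      have e : -(1 / D.f (u x) * v x) - lam * kap D / (2 * α) * x⁻¹
        = (-(x * mw D α x * v x) - lam / (2 * α) * D.f (u x) * (kap D * mw D α x))
          / (D.f (u x) * x * mw D α x) := by field_simp
      rw [e]
      apply div_nonneg (by linarith) (by positivity))
  nlinarith

lemma Facts.final {D : GelfandData} {α lam : ℝ} {u v : ℝ → ℝ} (F : Facts D α lam u v)
    (hα : 0 < α) (hl : 0 < lam) {r1 r2 B C1 ℓ : ℝ} (h1 : 0 < r1) (h12 : 2 * r1 ≤ r2)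
    (h2 : r2 ≤ 1/2) (hB : 0 < B) (huB : u r1 ≤ B) (hℓ : 0 < ℓ) (hC1 : 0 < C1)
    (hlam : lam ≤ C1 * α / ℓ) (hmw : mw D α (2 * r1) * ℓ ≤ mw D α r2)
    {r : ℝ} (hr : r2 ≤ r) (hr1 : r ≤ 1) :
    u r ≤ (2 * B + C1 * D.f B * D.M (1/2)) / ℓ * Real.log (1/r)
      + 2 * C1 * D.f B / ℓ * ∫ s in (0:ℝ)..1, D.M s := by
  have fB := D.f_pos B hB.le
  have r0 : 0 < r := by linarith
  have M2 := M_one D (s := 1/2) (by norm_num)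
  have p1 : pf D α v r1 ≤ 2 * B * mw D α (2 * r1) := by
    obtain ⟨ξ, hξ, e⟩ := exists_hasDerivAt_eq_slope u v (show r1 < 2 * r1 by linarith)
      (F.uc.mono (Icc_subset_Icc h1.le (by linarith)))
      (fun x hx => F.ud x ⟨h1.trans hx.1, by linarith [hx.2]⟩)
    have hu2 := F.upos (2 * r1) ⟨by linarith, by linarith⟩
    have e2 : -v ξ * r1 = u r1 - u (2 * r1) := by
      rw [e]; field_simp; ring
    have hmono := F.pmono r1 ξ h1.le hξ.1.le (by linarith [hξ.2])
    have hm := mw_mono D hα.le (h1.trans hξ.1).le hξ.2.le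
    have hv : 0 ≤ -v ξ := by
      have := F.anti r1 (2 * r1) h1.le (by linarith) (by linarith)
      by_contra hc
      push Not at hc
      nlinarith
    have hx0 : 0 < ξ := h1.trans hξ.1
    have hx2 := hξ.2.le
    have := mw_pos D α ξ
    have m2 := mw_pos D α (2 * r1)
    calc pf D α v r1 ≤ pf D α v ξ := hmono
      _ = ξ * mw D α ξ * (-v ξ) := by unfold pf; ring
      _ ≤ (2 * r1) * mw D α (2 * r1) * (-v ξ) := by gcongr
      _ = 2 * (-v ξ * r1) * mw D α (2 * r1) := by ring
      _ ≤ 2 * B * mw D α (2 * r1) := by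
        apply mul_le_mul_of_nonneg_right _ m2.le
        rw [e2]; linarith
  have key : ∀ s ∈ Ioo r 1, -v s ≤ (2 * B + C1 * D.f B * D.M (1/2)) / ℓ * s⁻¹
      + 2 * C1 * D.f B / ℓ * D.M s := fun s hs => by
    have s0 : 0 < s := r0.trans hs.1
    have hs' : s ∈ Ico (0:ℝ) 1 := ⟨s0.le, hs.2⟩
    have Ms := M_one D hs'
    have hm := mw_pos D α s
    have r1s : r1 ≤ s := by linarith [hs.1]
    have q := le_of_hasDeriv (g := fun x => lam * D.f B * D.M s / α * mw D α x - pf D α v x)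
      r1s ((continuous_const.mul (mw_cont D α)).continuousOn.sub
        (F.pc.mono (Icc_subset_Icc h1.le hs.2.le)))
      (fun x hx => ((mw_deriv D α x).const_mul _).sub
        (F.pd x ⟨h1.trans hx.1, hx.2.trans hs.2⟩)) (fun x hx => by
        have x0 : 0 < x := h1.trans hx.1
        have xm := mul_pos x0 (mw_pos D α x)
        have c1 := M_ge D hs' (t := x) ⟨x0.le, hx.2.le⟩
        have hux := F.upos x ⟨x0.le, hx.2.trans hs.2⟩
        have c2 : D.f (u x) ≤ D.f B := D.f_mono hux.le hB.le
          ((F.anti r1 x h1.le hx.1.le (hx.2.trans hs.2).le).trans huB)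
        have c3 := D.f_pos (u x) hux.le
        have c4 := pse_nonneg D x
        have c5 : 0 ≤ lam * (D.M s * phe D x) := mul_nonneg hl.le (c4.trans c1)
        rw [sub_nonneg]
        calc lam * pse D x * D.f (u x) * (x * mw D α x)
            ≤ lam * (D.M s * phe D x) * D.f B * (x * mw D α x) := by gcongr
          _ = _ := by field_simp)
    have m1 := mw_pos D α r1
    have : 0 ≤ lam * D.f B * D.M s / α * mw D α r1 := by positivity
    have m3 : mw D α (2 * r1) ≤ mw D α s / ℓ := by
      rw [le_div_iff₀ hℓ]
      exact hmw.trans (mw_mono D hα.le (by linarith) (by linarith [hs.1]))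
    have ps : pf D α v s ≤ 2 * B * (mw D α s / ℓ) + lam * D.f B * D.M s / α * mw D α s := by
      have : 2 * B * mw D α (2 * r1) ≤ 2 * B * (mw D α s / ℓ) := by gcongr
      linarith
    have vs : -v s = pf D α v s / (s * mw D α s) := by unfold pf; field_simp
    have la : lam / α ≤ C1 / ℓ := by
      rw [div_le_div_iff₀ hα hℓ]
      rwa [le_div_iff₀ hℓ] at hlam
    have Mb : D.M s * s⁻¹ ≤ D.M (1/2) * s⁻¹ + 2 * D.M s := by
      have si : 0 < s⁻¹ := inv_pos.2 s0
      by_cases h : s ≤ 1/2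
      · have := M_mono D (s := 1/2) (by norm_num) ⟨s0.le, h⟩
        have : D.M s * s⁻¹ ≤ D.M (1/2) * s⁻¹ := by gcongr
        linarith
      · push Not at h
        have : s⁻¹ ≤ 2 := by rw [inv_le_comm₀ s0 (by norm_num)]; linarith
        nlinarith
    calc -v s ≤ (2 * B * (mw D α s / ℓ) + lam * D.f B * D.M s / α * mw D α s) / (s * mw D α s) := by
          rw [vs]; gcongr
      _ = 2 * B / ℓ * s⁻¹ + lam / α * (D.f B * (D.M s * s⁻¹)) := by field_simp
      _ ≤ 2 * B / ℓ * s⁻¹ + C1 / ℓ * (D.f B * (D.M (1/2) * s⁻¹ + 2 * D.M s)) := by gcongr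
      _ = _ := by ring
  have ci : ContinuousOn (fun s : ℝ => s⁻¹) (uIcc r 1) := by
    rw [uIcc_of_le hr1]
    exact continuousOn_id.inv₀ (fun x hx => (r0.trans_le hx.1).ne')
  have vi : IntervalIntegrable v volume r 1 := by
    apply ContinuousOn.intervalIntegrable
    rw [uIcc_of_le hr1]
    exact F.vc.mono (Icc_subset_Icc r0.le le_rfl)
  have ftc : ∫ s in r..1, -v s = u r := by
    rw [intervalIntegral.integral_neg, intervalIntegral.integral_eq_sub_of_hasDerivAt_of_le hr1
      (F.uc.mono (Icc_subset_Icc r0.le le_rfl))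
      (fun x hx => F.ud x ⟨r0.trans hx.1, hx.2⟩) vi, F.u1]
    ring
  have Mi := M_ii D r0.le hr1 le_rfl
  rw [← ftc]
  refine (intervalIntegral.integral_mono_on_of_le_Ioo hr1 vi.neg
    ((ci.intervalIntegrable.const_mul _).add (Mi.const_mul _)) key).trans ?_
  rw [intervalIntegral.integral_add (ci.intervalIntegrable.const_mul _) (Mi.const_mul _),
    intervalIntegral.integral_const_mul, intervalIntegral.integral_const_mul,
    integral_inv_of_pos r0 one_pos]
  have := M_integral_le D r0.le hr1
  have : 0 ≤ 2 * C1 * D.f B / ℓ := by positivity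
  gcongr

lemma ev (D : GelfandData) {δ s0 : ℝ} (hδ : δ ∈ Ioo (0:ℝ) (1/4)) (hs0 : 0 < s0) :
    ∃ α₀ : ℝ, ∀ α ≥ α₀, 3 ≤ α ∧ α ^ (-(1/4:ℝ)) ≤ s0 ∧ 2 ≤ α ^ δ ∧ α ^ (-(1/2 - 2*δ)) ≤ 1/2 ∧
      8 ≤ α ^ (2*δ) ∧ Real.log α ≤ D.phi (1/2) / 4 * α ^ (4*δ) := by
  have hp := D.phi_pos (1/2) (by norm_num)
  obtain ⟨d0, d1⟩ := hδ
  rw [← Filter.eventually_atTop (p := fun α : ℝ => 3 ≤ α ∧ α ^ (-(1/4:ℝ)) ≤ s0 ∧ 2 ≤ α ^ δ ∧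
    α ^ (-(1/2 - 2*δ)) ≤ 1/2 ∧
      8 ≤ α ^ (2*δ) ∧ Real.log α ≤ D.phi (1/2) / 4 * α ^ (4*δ))]
  have e1 := (tendsto_rpow_neg_atTop (show (0:ℝ) < 1/4 by norm_num)).eventually (ge_mem_nhds hs0)
  have e2 := (tendsto_rpow_atTop d0).eventually (eventually_ge_atTop 2)
  have e3 := (tendsto_rpow_neg_atTop (show (0:ℝ) < 1/2 - 2*δ by linarith)).eventually
    (ge_mem_nhds (show (0:ℝ) < 1/2 by norm_num))
  have e4 := (tendsto_rpow_atTop (show 0 < 2*δ by linarith)).eventually (eventually_ge_atTop 8)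
  have e5 := (isLittleO_log_rpow_atTop (show 0 < 4*δ by linarith)).bound
    (show 0 < D.phi (1/2) / 4 by positivity)
  filter_upwards [e1, e2, e3, e4, e5, eventually_ge_atTop 3] with α h1 h2 h3 h4 h5 h6
  refine ⟨h6, h1, h2, h3, h4, ?_⟩
  have a0 : 0 < α := by linarith
  rw [Real.norm_eq_abs, Real.norm_eq_abs, abs_of_pos (Real.rpow_pos_of_pos a0 _)] at h5
  exact (le_abs_self _).trans h5

lemma arith {P Q I l L : ℝ} (hl : 0 < l) (hL : 0 ≤ L) (hP : 0 ≤ P) (hQ : 0 ≤ Q * I) :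
    P / l * L + Q / l * I ≤ (P + Q * I) * (1 + L) / l := by
  have : P / l * L + Q / l * I = (P * L + Q * I) / l := by field_simp
  rw [this]
  apply div_le_div_of_nonneg_right _ hl.le
  nlinarith [mul_nonneg hQ hL]

set_option maxHeartbeats 1000000 in
lemma main (D : GelfandData) (θ δ : ℝ)
    (hθ : θ ∈ Ioc (0:ℝ) 1) (hδ : δ ∈ Ioo (0:ℝ) (1/4)) :
    ∃ c > (0:ℝ), ∃ α₀ : ℝ, ∀ α ≥ α₀, ∀ lam : ℝ, ∀ u : ℝ → ℝ,
      IsSolution D α lam u → θ * lamStar D α < lam → lam ≤ lamStar D α →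
      ∀ r : ℝ, α ^ (-(1/2 - 2*δ)) ≤ r → r ≤ 1 →
        u r ≤ c * (1 + Real.log (1/r)) / Real.log α := by
  obtain ⟨s0, hs0, hs1, hp⟩ := psi_half D
  obtain ⟨c0, hc0, hex⟩ := exists_sol D
  obtain ⟨α₀, hev⟩ := ev D hδ hs0
  have kp := kap_pos D
  have θ0 := hθ.1
  have d0 := hδ.1
  have phip := D.phi_pos (1/2) (by norm_num)
  have K0 : 0 ≤ D.K := (FF_nonneg D one_pos).trans (FF_le D one_pos)
  set C1 := 8 * (D.K + 1) / kap D with hC1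
  have C1p : 0 < C1 := by positivity
  -- upper bound for solvable parameters
  have up : ∀ α ≥ α₀, ∀ lam u, 0 < lam → IsSolution D α lam u → lam ≤ C1 * α / Real.log α := by
    intro α hα lam u hl hu
    obtain ⟨a3, as0, -⟩ := hev α hα
    have a0 : 0 < α := by linarith
    have lg : 0 < Real.log α := Real.log_pos (by linarith)
    have F := facts_of_sol D hl hu
    have ha : 0 < α ^ (-(1/2:ℝ)) := Real.rpow_pos_of_pos a0 _
    have hab : α ^ (-(1/2:ℝ)) ≤ s0 :=
      (Real.rpow_le_rpow_of_exponent_le (by linarith) (by norm_num)).trans as0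
    have hq : α * (α ^ (-(1/2:ℝ)))^2 = 1 := by
      rw [← Real.rpow_natCast, ← Real.rpow_mul a0.le]
      norm_num
      rw [Real.rpow_neg_one]; field_simp
    have g := F.FFgap a0 hl hs1 hp ha hab le_rfl hq.ge
    have u1 := F.upos _ ⟨ha.le, (by linarith : α ^ (-(1/2:ℝ)) < 1)⟩
    have u2 := F.upos s0 ⟨hs0.le, by linarith⟩
    have f1 := FF_le D u1
    have f2 := FF_nonneg D u2
    have l1 : Real.log (α ^ (-(1/2:ℝ))) = -(1/2) * Real.log α := Real.log_rpow a0 _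
    have l2 : -(1/4) * Real.log α ≤ Real.log s0 := by
      rw [← Real.log_rpow a0]
      exact Real.log_le_log (Real.rpow_pos_of_pos a0 _) as0
    have g2 : lam * kap D / (2 * α) * (1/4 * Real.log α) ≤ D.K + 1 := by
      have : lam * kap D / (2 * α) * (1/4 * Real.log α) ≤
        lam * kap D / (2 * α) * (Real.log s0 - Real.log (α ^ (-(1/2:ℝ)))) := by
        gcongr; linarith
      linarith
    rw [le_div_iff₀ lg, hC1]
    have e : lam * kap D / (2 * α) * (1/4 * Real.log α) = lam * Real.log α * (kap D / (8 * α)) := by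
      field_simp; norm_num
    rw [e] at g2
    rw [div_mul_eq_mul_div, le_div_iff₀ kp]
    rw [← mul_div_assoc, div_le_iff₀ (by positivity)] at g2
    linarith
  set ε := θ * c0 * kap D * δ / 2 with hε
  have εp : 0 < ε := by positivity
  obtain ⟨B, hBK, hB1⟩ := (((FF_tendsto D).eventually (lt_mem_nhds
    (show D.K - ε < D.K by linarith))).and (eventually_ge_atTop 1)).exists
  have hB : 0 < B := by linarith
  have fB := D.f_pos B hB.le
  have M2 := M_one D (s := 1/2) (by norm_num)
  have hI : 0 ≤ ∫ s in (0:ℝ)..1, D.M s := by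
    have := M_integral_le D (a := 1) zero_le_one le_rfl
    simpa using this
  refine ⟨(2 * B + C1 * D.f B * D.M (1/2)) + 2 * C1 * D.f B * ∫ s in (0:ℝ)..1, D.M s,
    by positivity, α₀, ?_⟩
  intro α hα lam u hu hl1 hl2 r hr hr1
  obtain ⟨a3, as0, ad, ar2, ad2, alog⟩ := hev α hα
  have a0 : 0 < α := by linarith
  have lg : 0 < Real.log α := Real.log_pos (by linarith)
  have bdd : BddAbove (solvableSet D α) :=
    ⟨C1 * α / Real.log α, fun x hx => by
      obtain ⟨hx0, w, hw⟩ := hx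
      exact up α hα x w hx0 hw⟩
  have ls : c0 * α / Real.log α ≤ lamStar D α := le_csSup bdd (hex α a3)
  have lam_lo : θ * (c0 * α / Real.log α) ≤ lam :=
    (mul_le_mul_of_nonneg_left ls θ0.le).trans hl1.le
  have hl : 0 < lam := lt_of_lt_of_le (by positivity) lam_lo
  have F := facts_of_sol D hl hu
  have lam_up := up α hα lam u hl hu
  set a := α ^ (-(1/2:ℝ)) with hadef
  set r1 := α ^ (-(1/2:ℝ) + δ) with hr1def
  set r2 := α ^ (-(1/2 - 2*δ)) with hr2def
  have ap : 0 < a := Real.rpow_pos_of_pos a0 _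
  have r1p : 0 < r1 := Real.rpow_pos_of_pos a0 _
  have r2p : 0 < r2 := Real.rpow_pos_of_pos a0 _
  have ar1 : a ≤ r1 := Real.rpow_le_rpow_of_exponent_le (by linarith) (by linarith)
  have r1s : r1 ≤ s0 :=
    (Real.rpow_le_rpow_of_exponent_le (by linarith) (by linarith [hδ.2])).trans as0
  have hq : α * a^2 = 1 := by
    rw [hadef, ← Real.rpow_natCast, ← Real.rpow_mul a0.le]
    norm_num
    rw [Real.rpow_neg_one]; field_simp
  have e1 : r1 = a * α ^ δ := by rw [hr1def, Real.rpow_add a0]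
  have e2 : r2 = r1 * α ^ δ := by
    rw [hr2def, hr1def, ← Real.rpow_add a0]; congr 1; ring
  have e3 : α ^ (2*δ) = (α ^ δ)^2 := by
    rw [← Real.rpow_natCast, ← Real.rpow_mul a0.le]; congr 1; push_cast; ring
  have e4 : α ^ (4*δ) = (α ^ δ)^4 := by
    rw [← Real.rpow_natCast, ← Real.rpow_mul a0.le]; congr 1; push_cast; ring
  have g := F.FFgap a0 hl hs1 hp ap ar1 r1s hq.ge
  have ua := F.upos a ⟨ap.le, by linarith⟩
  have ur1 := F.upos r1 ⟨r1p.le, by linarith⟩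
  have ll : Real.log r1 - Real.log a = δ * Real.log α := by
    rw [hr1def, hadef, Real.log_rpow a0, Real.log_rpow a0]; ring
  have gε : ε ≤ lam * kap D / (2 * α) * (Real.log r1 - Real.log a) := by
    rw [ll]
    calc ε = θ * (c0 * α / Real.log α) * kap D / (2 * α) * (δ * Real.log α) := by
          rw [hε]; field_simp
      _ ≤ _ := by gcongr
  have uB : u r1 ≤ B := by
    by_contra hc
    push Not at hc
    have := FF_mono D hB hc.le
    have := FF_le D ua
    linarith
  have h12 : 2 * r1 ≤ r2 := by rw [e2]; nlinarith
  have hmw : mw D α (2 * r1) * Real.log α ≤ mw D α r2 := by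
    refine le_trans ?_ (mw_lower D a0.le (by linarith) h12 ar2)
    apply mul_le_mul_of_nonneg_left _ (mw_pos D α _).le
    have x : D.phi (1/2) / 4 * α ^ (4*δ) ≤ α * (D.phi (1/2) / 2 * (r2^2 - (2 * r1)^2)) := by
      have y : α * (D.phi (1/2) / 2 * (r2^2 - (2 * r1)^2))
        = D.phi (1/2) / 2 * (α * a^2) * ((α ^ δ)^4 - 4 * (α ^ δ)^2) := by
        rw [e2, e1]; ring
      rw [y, hq, e4]
      rw [e3] at ad2
      have z : (α ^ δ)^4 / 2 ≤ (α ^ δ)^4 - 4 * (α ^ δ)^2 := by 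
        have w : 0 ≤ (α ^ δ)^2 * ((α ^ δ)^2 - 8) := mul_nonneg (sq_nonneg _) (by linarith)
        have w2 : (α ^ δ)^2 * ((α ^ δ)^2 - 8) = (α ^ δ)^4 - 8 * (α ^ δ)^2 := by ring
        linarith
      have z2 := mul_le_mul_of_nonneg_left z (show 0 ≤ D.phi (1/2) / 2 by linarith)
      linarith
    have := Real.add_one_le_exp (α * (D.phi (1/2) / 2 * (r2^2 - (2 * r1)^2)))
    linarith
  refine (F.final a0 hl r1p h12 ar2 hB uB lg C1p lam_up hmw hr hr1).trans ?_
  have rp : 0 < r := by linarith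
  have lr : 0 ≤ Real.log (1/r) := Real.log_nonneg (by rw [le_div_iff₀ rp]; linarith)
  have t1 : 0 ≤ 2 * B + C1 * D.f B * D.M (1/2) := by positivity
  have t2 : 0 ≤ 2 * C1 * D.f B * ∫ s in (0:ℝ)..1, D.M s := by positivity
  exact arith lg lr t1 t2

end GJ

/-- For `ϑ ∈ (0,1]` and `δ ∈ (0,1/4)` there are `c > 0` and `α₀`
such that for `α ≥ α₀`, every solution of `(P_{α,λ})` with `ϑ λ*(α) < λ ≤ λ*(α)`
satisfies `u(r) ≤ c (1 + log(1/r))/log α` for `r ∈ [α^{-(1/2 - 2δ)}, 1]`. -/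
theorem solution_decay_bound (D : GelfandData) (θ δ : ℝ)
    (hθ : θ ∈ Ioc (0:ℝ) 1) (hδ : δ ∈ Ioo (0:ℝ) (1/4)) :
    ∃ c > (0:ℝ), ∃ α₀ : ℝ, ∀ α ≥ α₀, ∀ lam : ℝ, ∀ u : ℝ → ℝ,
      IsSolution D α lam u → θ * lamStar D α < lam → lam ≤ lamStar D α →
      ∀ r : ℝ, α ^ (-(1/2 - 2*δ)) ≤ r → r ≤ 1 →
        u r ≤ c * (1 + Real.log (1/r)) / Real.log α := by
  exact GJ.main D θ δ hθ hδ
end
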